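/- Suppose d ≤ 2, let c ∈ ℭ_+, let γ_k, k ∈ Λ \ {0}, be complex numbers with γ_{−k} = conj(γ_k), set γ_0 = 1, and let λ > 0. Then the regularized functional J_λ(P,Q) := ⟨c,q⟩ − ⟨γ,p⟩ + ∫_{𝕋^d} P log(P/Q) dm − λ ∫_{𝕋^d} log P dm is strictly convex on 𝔓_{+,∘} × 𝔓_+ and has a unique minimizer (P̂, Q̂) ∈ 𝔓_{+,∘} × 𝔓_+. Moreover, Φ = P̂/Q̂ satisfies the exact covariance matching c_k = ∫_{𝕋^d} e^{i(k,θ)} Φ dm for all k ∈ Λ, and the approximate cepstral matching γ_k + ε_k = ∫_{𝕋^d} e^{i(k,θ)} log Φ dm for all k ∈ Λ \ {0}, where ε_k = λ ∫_{𝕋^d} e^{i(k,θ)} P̂^{−1} dm. -/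

import Mathlib

open MeasureTheory Complex Set

noncomputable section

namespace RCE

/-- The scalar product (k,θ) = Σⱼ kⱼ θⱼ. -/
def dotP (d : ℕ) (k : Fin d → ℤ) (θ : Fin d → ℝ) : ℝ := ∑ j, (k j : ℝ) * θ j

/-- The d-dimensional torus 𝕋^d = (−π,π]^d. -/
def Td (d : ℕ) : Set (Fin d → ℝ) := Set.univ.pi fun _ => Set.Ioc (-Real.pi) Real.pi

/-- Normalized Lebesgue measure dm = (2π)^{-d} dθ on 𝕋^d. -/
def dm (d : ℕ) : Measure (Fin d → ℝ) :=
  (ENNReal.ofReal ((2 * Real.pi) ^ d))⁻¹ • (volume.restrict (Td d))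

/-- Conjugate-symmetric coefficient sequences supported on Λ. -/
def IsCoeff (d : ℕ) (Λ : Finset (Fin d → ℤ)) (p : (Fin d → ℤ) → ℂ) : Prop :=
  (∀ k, k ∉ Λ → p k = 0) ∧ ∀ k, p (-k) = starRingEnd ℂ (p k)

/-- Evaluation of the (real-valued) trigonometric polynomial
`P(e^{iθ}) = Σ_{k∈Λ} p_k e^{-i(k,θ)}`. -/
def eval (d : ℕ) (Λ : Finset (Fin d → ℤ)) (p : (Fin d → ℤ) → ℂ) (θ : Fin d → ℝ) : ℝ :=
  (∑ k ∈ Λ, p k * Complex.exp (-(dotP d k θ : ℂ) * Complex.I)).re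

/-- `𝔓̄₊` : the closed cone of nonnegative trigonometric polynomials. -/
def Pbar (d : ℕ) (Λ : Finset (Fin d → ℤ)) : Set ((Fin d → ℤ) → ℂ) :=
  {p | IsCoeff d Λ p ∧ ∀ θ ∈ Td d, 0 ≤ eval d Λ p θ}

/-- `𝔓₊` : the open cone of positive trigonometric polynomials. -/
def Pplus (d : ℕ) (Λ : Finset (Fin d → ℤ)) : Set ((Fin d → ℤ) → ℂ) :=
  {p | IsCoeff d Λ p ∧ ∀ θ ∈ Td d, 0 < eval d Λ p θ}

/-- The pairing ⟨c,p⟩ = Σ_{k∈Λ} c_k conj(p_k) (real-valued by conjugate symmetry). -/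
def pair (d : ℕ) (Λ : Finset (Fin d → ℤ)) (c p : (Fin d → ℤ) → ℂ) : ℝ :=
  (∑ k ∈ Λ, c k * starRingEnd ℂ (p k)).re

/-- `ℭ₊` : the interior of the dual cone. -/
def Cplus (d : ℕ) (Λ : Finset (Fin d → ℤ)) : Set ((Fin d → ℤ) → ℂ) :=
  {c | IsCoeff d Λ c ∧ ∀ p ∈ Pbar d Λ, p ≠ 0 → 0 < pair d Λ c p}

/-- `ℭ̄₊` : the closed dual cone. -/
def Cbar (d : ℕ) (Λ : Finset (Fin d → ℤ)) : Set ((Fin d → ℤ) → ℂ) :=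
  {c | IsCoeff d Λ c ∧ ∀ p ∈ Pbar d Λ, 0 ≤ pair d Λ c p}

/-- The dual functional J_P(Q) = ⟨c,q⟩ − ∫ P log Q dm. -/
def J (d : ℕ) (Λ : Finset (Fin d → ℤ)) (c P Q : (Fin d → ℤ) → ℂ) : ℝ :=
  pair d Λ c Q - ∫ θ, eval d Λ P θ * Real.log (eval d Λ Q θ) ∂(dm d)

/-- Covariance matching for an absolutely continuous measure Φ dm:
`c_k = ∫ e^{i(k,θ)} Φ(θ) dm(θ)` for all k ∈ Λ. -/
def Matches (d : ℕ) (Λ : Finset (Fin d → ℤ)) (c : (Fin d → ℤ) → ℂ)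
    (Φ : (Fin d → ℝ) → ℝ) : Prop :=
  ∀ k ∈ Λ, c k = ∫ θ, Complex.exp ((dotP d k θ : ℂ) * Complex.I) * (Φ θ : ℂ) ∂(dm d)

/-- `𝔓₊,∘` : positive trigonometric polynomials normalized by p₀ = 1. -/
def Ppluso (d : ℕ) (Λ : Finset (Fin d → ℤ)) : Set ((Fin d → ℤ) → ℂ) :=
  {p | p ∈ Pplus d Λ ∧ p 0 = 1}

/-- The regularized functional
J_λ(P,Q) = ⟨c,q⟩ − ⟨γ,p⟩ + ∫ P log(P/Q) dm − λ ∫ log P dm. -/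
def Jlam (d : ℕ) (Λ : Finset (Fin d → ℤ)) (c γ : (Fin d → ℤ) → ℂ) (lam : ℝ)
    (P Q : (Fin d → ℤ) → ℂ) : ℝ :=
  pair d Λ c Q - pair d Λ γ P +
    (∫ θ, eval d Λ P θ * Real.log (eval d Λ P θ / eval d Λ Q θ) ∂(dm d)) -
    lam * ∫ θ, Real.log (eval d Λ P θ) ∂(dm d)

lemma Td_ae_eq_Icc (d : ℕ) :
    Td d =ᵐ[volume] Set.Icc (fun _ => -Real.pi) (fun _ => Real.pi) :=
  Measure.univ_pi_Ioc_ae_eq_Icc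

lemma dm_eq_smul_pi (d : ℕ) : dm d = (ENNReal.ofReal ((2 * Real.pi) ^ d))⁻¹ •
    Measure.pi (fun _ : Fin d => volume.restrict (Set.Ioc (-Real.pi) Real.pi)) := by
  rw [dm, Td, volume_pi, Measure.restrict_pi_pi]

lemma dm_eq_smul_Icc (d : ℕ) : dm d = (ENNReal.ofReal ((2 * Real.pi) ^ d))⁻¹ •
    volume.restrict (Set.Icc (fun _ : Fin d => -Real.pi) (fun _ => Real.pi)) := by
  rw [dm, Measure.restrict_congr_set (Td_ae_eq_Icc d)]

lemma integral_dm {E : Type*} [NormedAddCommGroup E] [NormedSpace ℝ E] (d : ℕ)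
    (f : (Fin d → ℝ) → E) :
    ∫ θ, f θ ∂(dm d) = ((2 * Real.pi) ^ d)⁻¹ •
      ∫ θ in Set.Icc (fun _ : Fin d => -Real.pi) (fun _ => Real.pi), f θ := by
  have : (0 : ℝ) ≤ (2 * Real.pi) ^ d := by positivity
  rw [dm_eq_smul_Icc, integral_smul_measure, ENNReal.toReal_inv, ENNReal.toReal_ofReal this]

lemma ofReal_two_pi_pow_inv_ne_top (d : ℕ) :
    (ENNReal.ofReal ((2 * Real.pi) ^ d))⁻¹ ≠ ⊤ := by
  have : (0 : ℝ) < (2 * Real.pi) ^ d := by positivity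
  simpa using this

instance (d : ℕ) : IsProbabilityMeasure (dm d) := by
  constructor
  have h : (0 : ℝ) < (2 * Real.pi) ^ d := by positivity
  rw [dm_eq_smul_pi]
  simp only [Measure.smul_apply, Measure.pi_univ, Measure.restrict_apply_univ, Real.volume_Ioc,
    Finset.prod_const, Finset.card_univ, Fintype.card_fin, smul_eq_mul]
  rw [show Real.pi - -Real.pi = 2 * Real.pi by ring, ← ENNReal.ofReal_pow (by positivity)]
  exact ENNReal.inv_mul_cancel (by simpa using h) (by simp)

lemma integrable_dm_of_continuous {E : Type*} [NormedAddCommGroup E] {d : ℕ}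
    {f : (Fin d → ℝ) → E} (hf : Continuous f) : Integrable f (dm d) := by
  rw [dm_eq_smul_Icc]
  exact (hf.continuousOn.integrableOn_compact isCompact_Icc).smul_measure
    (ofReal_two_pi_pow_inv_ne_top d)

lemma continuous_integral_dm {X : Type*} [TopologicalSpace X] [FirstCountableTopology X]
    [LocallyCompactSpace X] {d : ℕ} {f : X → (Fin d → ℝ) → ℝ} (hf : Continuous f.uncurry) :
    Continuous fun x => ∫ θ, f x θ ∂(dm d) := by
  simp_rw [integral_dm]
  have h := continuous_parametric_integral_of_continuous (μ := volume) hf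
    (isCompact_Icc (a := fun _ : Fin d => -Real.pi) (b := fun _ => Real.pi))
  exact h.const_smul (((2 * Real.pi) ^ d)⁻¹ : ℝ)

lemma measurePreserving_toIocMod_add {T : ℝ} (hT : 0 < T) (t a : ℝ) :
    MeasurePreserving (fun x => toIocMod hT t (a + x))
      (volume.restrict (Set.Ioc t (t + T))) (volume.restrict (Set.Ioc t (t + T))) := by
  have : Fact (0 < T) := ⟨hT⟩
  have h1 := AddCircle.measurePreserving_mk T t
  have h2 := measurePreserving_add_left (volume : Measure (AddCircle T)) (a : AddCircle T)
  have h3 := AddCircle.measurePreserving_equivIoc T (a := t)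
  have h4 : MeasurePreserving (Subtype.val : Set.Ioc t (t + T) → ℝ)
      (Measure.comap Subtype.val volume) (volume.restrict (Set.Ioc t (t + T))) :=
    measurePreserving_subtype_coe measurableSet_Ioc
  exact h4.comp (h3.comp (h2.comp h1))

/-- Translation by `a` on the torus, realised on the fundamental domain `Td d`. -/
def shift {d : ℕ} (a θ : Fin d → ℝ) : Fin d → ℝ :=
  fun j => toIocMod Real.two_pi_pos (-Real.pi) (a j + θ j)

lemma shift_mem_Td {d : ℕ} (a θ : Fin d → ℝ) : shift a θ ∈ Td d := by
  intro j _
  have := toIocMod_mem_Ioc Real.two_pi_pos (-Real.pi) (a j + θ j)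
  rwa [show -Real.pi + 2 * Real.pi = Real.pi by ring] at this

lemma measurePreserving_shift {d : ℕ} (a : Fin d → ℝ) :
    MeasurePreserving (shift a) (dm d) (dm d) := by
  rw [dm_eq_smul_pi]
  refine MeasurePreserving.smul_measure ?_ _
  refine measurePreserving_pi (f := fun j x => toIocMod Real.two_pi_pos (-Real.pi) (a j + x))
    (fun _ : Fin d => volume.restrict (Set.Ioc (-Real.pi) Real.pi))
    (fun _ => volume.restrict (Set.Ioc (-Real.pi) Real.pi)) fun j => ?_
  have := measurePreserving_toIocMod_add Real.two_pi_pos (-Real.pi) (a j)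
  rwa [show -Real.pi + 2 * Real.pi = Real.pi by ring] at this

lemma exp_dotP_shift {d : ℕ} (k : Fin d → ℤ) (a θ : Fin d → ℝ) :
    Complex.exp ((dotP d k (shift a θ) : ℂ) * Complex.I) =
      Complex.exp ((dotP d k (a + θ) : ℂ) * Complex.I) := by
  rw [Complex.exp_eq_exp_iff_exists_int]
  refine ⟨-∑ j, k j * toIocDiv Real.two_pi_pos (-Real.pi) (a j + θ j), ?_⟩
  simp only [dotP, shift, toIocMod, Pi.add_apply]
  push_cast
  rw [Finset.sum_mul, Finset.sum_mul, ← Finset.sum_neg_distrib, Finset.sum_mul,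
    ← Finset.sum_add_distrib]
  refine Finset.sum_congr rfl fun j _ => ?_
  simp only [zsmul_eq_mul]
  ring

lemma dotP_add (d : ℕ) (k : Fin d → ℤ) (a b : Fin d → ℝ) :
    dotP d k (a + b) = dotP d k a + dotP d k b := by
  simp [dotP, mul_add, Finset.sum_add_distrib]

lemma dotP_neg (d : ℕ) (k : Fin d → ℤ) (a : Fin d → ℝ) : dotP d k (-a) = -dotP d k a := by
  simp [dotP]

lemma dotP_neg_left (d : ℕ) (k : Fin d → ℤ) (a : Fin d → ℝ) : dotP d (-k) a = -dotP d k a := by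
  simp [dotP]

lemma dotP_zero_left (d : ℕ) (a : Fin d → ℝ) : dotP d 0 a = 0 := by
  simp [dotP]

lemma dotP_sub_left (d : ℕ) (k l : Fin d → ℤ) (a : Fin d → ℝ) :
    dotP d (k - l) a = dotP d k a - dotP d l a := by
  simp [dotP, sub_mul, Finset.sum_sub_distrib]

@[fun_prop]
lemma continuous_dotP (d : ℕ) (k : Fin d → ℤ) : Continuous (dotP d k) := by
  unfold dotP; fun_prop

lemma abs_dotP_le (d : ℕ) (k : Fin d → ℤ) (x : Fin d → ℝ) :
    |dotP d k x| ≤ (∑ j, |(k j : ℝ)|) * ‖x‖ := by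
  rw [dotP, Finset.sum_mul]
  refine (Finset.abs_sum_le_sum_abs _ _).trans (Finset.sum_le_sum fun j _ => ?_)
  rw [abs_mul]
  exact mul_le_mul_of_nonneg_left (norm_le_pi_norm x j) (abs_nonneg _)

lemma integral_exp_int_mul (n : ℤ) (hn : n ≠ 0) :
    ∫ x in Set.Ioc (-Real.pi) Real.pi, Complex.exp (((n : ℝ) * x : ℝ) * Complex.I) = 0 := by
  have hc : (n : ℂ) * Complex.I ≠ 0 := by simp [hn]
  have h := integral_exp_mul_complex (a := -Real.pi) (b := Real.pi) hc
  rw [intervalIntegral.integral_of_le (by linarith [Real.pi_pos])] at h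
  have e : ∀ x : ℝ, Complex.exp (((n : ℝ) * x : ℝ) * Complex.I) =
      Complex.exp ((n : ℂ) * Complex.I * x) := fun x => by push_cast; ring_nf
  simp_rw [e]
  rw [h, div_eq_zero_iff]
  left
  rw [sub_eq_zero, Complex.exp_eq_exp_iff_exists_int]
  exact ⟨n, by push_cast; ring⟩

lemma integral_exp_dotP (d : ℕ) (k : Fin d → ℤ) :
    ∫ θ, Complex.exp ((dotP d k θ : ℂ) * Complex.I) ∂(dm d) = if k = 0 then 1 else 0 := by
  split_ifs with hk
  · subst hk; simp [dotP_zero_left]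
  · obtain ⟨j, hj⟩ : ∃ j, k j ≠ 0 := by
      by_contra! h
      exact hk (funext h)
    rw [dm_eq_smul_pi, integral_smul_measure]
    have e : ∀ θ : Fin d → ℝ, Complex.exp ((dotP d k θ : ℂ) * Complex.I) =
        ∏ i, Complex.exp (((k i : ℝ) * θ i : ℝ) * Complex.I) := fun θ => by
      rw [← Complex.exp_sum, dotP, ← Finset.sum_mul]; push_cast; rfl
    simp_rw [e]
    rw [integral_fintype_prod_eq_prod
      (f := fun i (x : ℝ) => Complex.exp (((k i : ℝ) * x : ℝ) * Complex.I)),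
      Finset.prod_eq_zero (Finset.mem_univ j) (integral_exp_int_mul _ hj), smul_zero]

variable {d : ℕ} {Λ : Finset (Fin d → ℤ)} {p q a h : (Fin d → ℤ) → ℂ}

lemma eval_add (p q : (Fin d → ℤ) → ℂ) (θ : Fin d → ℝ) :
    eval d Λ (p + q) θ = eval d Λ p θ + eval d Λ q θ := by
  simp only [eval, Pi.add_apply, add_mul, Finset.sum_add_distrib, Complex.add_re]

lemma eval_smul (t : ℝ) (p : (Fin d → ℤ) → ℂ) (θ : Fin d → ℝ) :
    eval d Λ (t • p) θ = t * eval d Λ p θ := by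
  simp only [eval, Pi.smul_apply, smul_mul_assoc, ← Finset.smul_sum, Complex.smul_re, smul_eq_mul]

lemma eval_neg (p : (Fin d → ℤ) → ℂ) (θ : Fin d → ℝ) : eval d Λ (-p) θ = -eval d Λ p θ := by
  simpa using eval_smul (Λ := Λ) (-1) p θ

lemma eval_sub (p q : (Fin d → ℤ) → ℂ) (θ : Fin d → ℝ) :
    eval d Λ (p - q) θ = eval d Λ p θ - eval d Λ q θ := by
  rw [sub_eq_add_neg, eval_add, eval_neg, sub_eq_add_neg]

lemma pair_add (a p q : (Fin d → ℤ) → ℂ) :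
    pair d Λ a (p + q) = pair d Λ a p + pair d Λ a q := by
  simp only [pair, Pi.add_apply, map_add, mul_add, Finset.sum_add_distrib, Complex.add_re]

lemma pair_smul (t : ℝ) (a p : (Fin d → ℤ) → ℂ) :
    pair d Λ a (t • p) = t * pair d Λ a p := by
  have : ∀ k, a k * starRingEnd ℂ ((t • p) k) = t • (a k * starRingEnd ℂ (p k)) := fun k => by
    simp only [Pi.smul_apply, Complex.real_smul, map_mul, Complex.conj_ofReal]; ring
  simp only [pair, this, ← Finset.smul_sum, Complex.smul_re, smul_eq_mul]

lemma pair_neg (a p : (Fin d → ℤ) → ℂ) : pair d Λ a (-p) = -pair d Λ a p := by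
  simpa using pair_smul (Λ := Λ) (-1) a p

lemma pair_sub (a p q : (Fin d → ℤ) → ℂ) :
    pair d Λ a (p - q) = pair d Λ a p - pair d Λ a q := by
  rw [sub_eq_add_neg, pair_add, pair_neg, sub_eq_add_neg]

@[simp]
lemma eval_zero (θ : Fin d → ℝ) : eval d Λ 0 θ = 0 := by simp [eval]

@[simp]
lemma pair_zero (a : (Fin d → ℤ) → ℂ) : pair d Λ a 0 = 0 := by simp [pair]

lemma isCoeff_zero : IsCoeff d Λ 0 := ⟨fun _ _ => rfl, fun _ => by simp⟩

lemma pair_sub_left (a b p : (Fin d → ℤ) → ℂ) :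
    pair d Λ (a - b) p = pair d Λ a p - pair d Λ b p := by
  simp only [pair, Pi.sub_apply, sub_mul, Finset.sum_sub_distrib, Complex.sub_re]

@[fun_prop]
lemma continuous_eval :
    Continuous fun x : ((Fin d → ℤ) → ℂ) × (Fin d → ℝ) => eval d Λ x.1 x.2 := by
  unfold eval dotP; fun_prop

@[fun_prop]
lemma continuous_eval_right (p : (Fin d → ℤ) → ℂ) : Continuous (eval d Λ p) := by
  unfold eval dotP; fun_prop

lemma continuous_pair (a : (Fin d → ℤ) → ℂ) : Continuous (pair d Λ a) := by
  unfold pair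
  refine Complex.continuous_re.comp (continuous_finsetSum _ fun k _ => ?_)
  exact continuous_const.mul (Complex.continuous_conj.comp (continuous_apply k))

lemma eval_shift (p : (Fin d → ℤ) → ℂ) (a θ : Fin d → ℝ) :
    eval d Λ p (shift a θ) = eval d Λ p (a + θ) := by
  simp only [eval]
  congr 1
  refine Finset.sum_congr rfl fun k _ => ?_
  have := exp_dotP_shift (-k) a θ
  simp only [dotP_neg_left, Complex.ofReal_neg] at this
  rw [this]

lemma exists_mem_Td_eval_eq (p : (Fin d → ℤ) → ℂ) (θ : Fin d → ℝ) :
    ∃ θ' ∈ Td d, eval d Λ p θ = eval d Λ p θ' :=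
  ⟨shift 0 θ, shift_mem_Td 0 θ, by rw [eval_shift, zero_add]⟩

lemma integral_eval_add (p : (Fin d → ℤ) → ℂ) (f : ℝ → ℝ) (θ₀ : Fin d → ℝ)
    (hf : Continuous fun θ => f (eval d Λ p θ)) :
    ∫ θ, f (eval d Λ p (θ₀ + θ)) ∂(dm d) = ∫ θ, f (eval d Λ p θ) ∂(dm d) := by
  have hm := measurePreserving_shift θ₀
  conv_rhs => rw [← hm.map_eq]
  rw [integral_map hm.measurable.aemeasurable hf.aestronglyMeasurable]
  simp_rw [eval_shift]

lemma eval_pos_of_mem_Pplus (hp : p ∈ Pplus d Λ) (θ : Fin d → ℝ) : 0 < eval d Λ p θ := by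
  obtain ⟨θ', h', e⟩ := exists_mem_Td_eval_eq (Λ := Λ) p θ
  exact e ▸ hp.2 θ' h'

lemma mem_Pbar_of_mem_Pplus (hp : p ∈ Pplus d Λ) : p ∈ Pbar d Λ :=
  ⟨hp.1, fun θ hθ => (hp.2 θ hθ).le⟩

lemma IsCoeff.add (hp : IsCoeff d Λ p) (hq : IsCoeff d Λ q) : IsCoeff d Λ (p + q) :=
  ⟨fun k hk => by simp [hp.1 k hk, hq.1 k hk], fun k => by simp [hp.2 k, hq.2 k]⟩

lemma IsCoeff.smul (t : ℝ) (hp : IsCoeff d Λ p) : IsCoeff d Λ (t • p) :=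
  ⟨fun k hk => by simp [hp.1 k hk], fun k => by simp [hp.2 k]⟩

lemma IsCoeff.neg (hp : IsCoeff d Λ p) : IsCoeff d Λ (-p) := by
  simpa using hp.smul (-1)

lemma IsCoeff.sub (hp : IsCoeff d Λ p) (hq : IsCoeff d Λ q) : IsCoeff d Λ (p - q) := by
  simpa [sub_eq_add_neg] using hp.add hq.neg

lemma IsCoeff.ofReal_re_zero (hp : IsCoeff d Λ p) : ((p 0).re : ℂ) = p 0 := by
  have := hp.2 0
  rw [neg_zero] at this
  exact Complex.conj_eq_iff_re.mp this.symm

lemma IsCoeff.ofReal_eval (hΛ : ∀ k ∈ Λ, -k ∈ Λ) (hp : IsCoeff d Λ p) (θ : Fin d → ℝ) :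
    (eval d Λ p θ : ℂ) = ∑ k ∈ Λ, p k * Complex.exp (-(dotP d k θ : ℂ) * Complex.I) := by
  rw [eval, ← Complex.conj_eq_iff_re, map_sum]
  refine Finset.sum_nbij' (fun k => -k) (fun k => -k) hΛ hΛ (by simp) (by simp) fun k _ => ?_
  rw [map_mul, ← hp.2 k, ← Complex.exp_conj]
  simp [dotP_neg_left]

lemma IsCoeff.integral_exp_mul_eval (hΛ : ∀ k ∈ Λ, -k ∈ Λ) (hp : IsCoeff d Λ p)
    (k : Fin d → ℤ) :
    ∫ θ, Complex.exp ((dotP d k θ : ℂ) * Complex.I) * (eval d Λ p θ : ℂ) ∂(dm d) = p k := by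
  have e : ∀ θ, Complex.exp ((dotP d k θ : ℂ) * Complex.I) * (eval d Λ p θ : ℂ) =
      ∑ l ∈ Λ, p l * Complex.exp ((dotP d (k - l) θ : ℂ) * Complex.I) := fun θ => by
    rw [hp.ofReal_eval hΛ, Finset.mul_sum]
    refine Finset.sum_congr rfl fun l _ => ?_
    rw [mul_left_comm, ← Complex.exp_add, dotP_sub_left]
    push_cast
    ring_nf
  simp_rw [e]
  rw [integral_finsetSum _ fun l _ => integrable_dm_of_continuous (by fun_prop)]
  simp_rw [integral_const_mul, integral_exp_dotP, sub_eq_zero, mul_ite, mul_one, mul_zero]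
  rw [Finset.sum_ite_eq]
  split_ifs with hk
  · rfl
  · exact (hp.1 k hk).symm

lemma IsCoeff.integral_eval (hΛ : ∀ k ∈ Λ, -k ∈ Λ) (hp : IsCoeff d Λ p) :
    ∫ θ, eval d Λ p θ ∂(dm d) = (p 0).re := by
  have := hp.integral_exp_mul_eval hΛ 0
  simp only [dotP_zero_left, Complex.ofReal_zero, zero_mul, Complex.exp_zero, one_mul] at this
  rw [integral_complex_ofReal] at this
  rw [← this, Complex.ofReal_re]

lemma eval_nonneg_of_mem_Pbar (hp : p ∈ Pbar d Λ) (θ : Fin d → ℝ) : 0 ≤ eval d Λ p θ := by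
  obtain ⟨θ', h', e⟩ := exists_mem_Td_eval_eq (Λ := Λ) p θ
  exact e ▸ hp.2 θ' h'

lemma norm_exp_dotP (k : Fin d → ℤ) (θ : Fin d → ℝ) :
    ‖Complex.exp ((dotP d k θ : ℂ) * Complex.I)‖ = 1 := Complex.norm_exp_ofReal_mul_I _

lemma norm_le_of_mem_Pbar (hΛ : ∀ k ∈ Λ, -k ∈ Λ) (hp : p ∈ Pbar d Λ) (k : Fin d → ℤ) :
    ‖p k‖ ≤ (p 0).re := by
  rw [← hp.1.integral_exp_mul_eval hΛ k, ← hp.1.integral_eval hΛ]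
  refine (norm_integral_le_integral_norm _).trans_eq (integral_congr_ae (.of_forall fun θ => ?_))
  simp only [norm_mul, norm_exp_dotP, one_mul, Complex.norm_real, Real.norm_eq_abs]
  exact abs_of_nonneg (eval_nonneg_of_mem_Pbar hp θ)

lemma abs_eval_le (p : (Fin d → ℤ) → ℂ) (θ : Fin d → ℝ) :
    |eval d Λ p θ| ≤ ∑ k ∈ Λ, ‖p k‖ := by
  refine (Complex.abs_re_le_norm _).trans ((norm_sum_le _ _).trans_eq
    (Finset.sum_congr rfl fun k _ => ?_))
  rw [norm_mul, ← Complex.ofReal_neg, Complex.norm_exp_ofReal_mul_I, mul_one]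

lemma IsCoeff.eq_of_ae_eq (hΛ : ∀ k ∈ Λ, -k ∈ Λ) (hp : IsCoeff d Λ p) (hq : IsCoeff d Λ q)
    (h : ∀ᵐ θ ∂(dm d), eval d Λ p θ = eval d Λ q θ) : p = q := by
  funext k
  rw [← hp.integral_exp_mul_eval hΛ k, ← hq.integral_exp_mul_eval hΛ k]
  refine integral_congr_ae ?_
  filter_upwards [h] with θ hθ
  rw [hθ]

/-- The Fourier coefficients `∫ e^{i(k,θ)} f dm` for `k ∈ Λ`, extended by zero. -/
def coeff (d : ℕ) (Λ : Finset (Fin d → ℤ)) (f : (Fin d → ℝ) → ℝ) (k : Fin d → ℤ) : ℂ :=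
  open Classical in
  if k ∈ Λ then ∫ θ, Complex.exp ((dotP d k θ : ℂ) * Complex.I) * (f θ : ℂ) ∂(dm d) else 0

lemma isCoeff_coeff (hΛ : ∀ k ∈ Λ, -k ∈ Λ) (f : (Fin d → ℝ) → ℝ) :
    IsCoeff d Λ (coeff d Λ f) := by
  refine ⟨fun k hk => if_neg hk, fun k => ?_⟩
  have hk : -k ∈ Λ ↔ k ∈ Λ := ⟨fun h => by simpa using hΛ _ h, hΛ k⟩
  simp only [coeff, hk]
  split_ifs
  · rw [← integral_conj]
    congr 1
    funext θ
    simp [← Complex.exp_conj, dotP_neg_left]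
  · simp

lemma pair_coeff (hΛ : ∀ k ∈ Λ, -k ∈ Λ) {f : (Fin d → ℝ) → ℝ} (hf : Continuous f)
    (hh : IsCoeff d Λ h) : pair d Λ (coeff d Λ f) h = ∫ θ, f θ * eval d Λ h θ ∂(dm d) := by
  have key : ∑ k ∈ Λ, coeff d Λ f k * starRingEnd ℂ (h k) =
      ((∫ θ, f θ * eval d Λ h θ ∂(dm d) : ℝ) : ℂ) := by
    rw [← integral_complex_ofReal]
    have e : ∀ θ, ((f θ * eval d Λ h θ : ℝ) : ℂ) = ∑ k ∈ Λ,
        Complex.exp ((dotP d k θ : ℂ) * Complex.I) * (f θ : ℂ) * starRingEnd ℂ (h k) := fun θ => by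
      rw [Complex.ofReal_mul, hh.ofReal_eval hΛ, Finset.mul_sum]
      refine Finset.sum_nbij' (fun k => -k) (fun k => -k) hΛ hΛ (by simp) (by simp) fun k _ => ?_
      rw [← hh.2, neg_neg, dotP_neg_left]
      push_cast
      ring
    simp_rw [e]
    rw [integral_finsetSum _ fun l _ => integrable_dm_of_continuous (by fun_prop)]
    refine Finset.sum_congr rfl fun k hk => ?_
    rw [integral_mul_const, coeff, if_pos hk]
  rw [pair, key, Complex.ofReal_re]

lemma pair_self (a : (Fin d → ℤ) → ℂ) : pair d Λ a a = ∑ k ∈ Λ, ‖a k‖ ^ 2 := by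
  simp only [pair, Complex.re_sum]
  refine Finset.sum_congr rfl fun k _ => ?_
  rw [Complex.mul_conj, Complex.ofReal_re, Complex.normSq_eq_norm_sq]

lemma eq_zero_of_pair_self (ha : pair d Λ a a = 0) (k : Fin d → ℤ) (hk : k ∈ Λ) : a k = 0 := by
  rw [pair_self, Finset.sum_eq_zero_iff_of_nonneg fun _ _ => by positivity] at ha
  simpa using ha k hk

lemma abs_pair_le (a p : (Fin d → ℤ) → ℂ) {M : ℝ} (hM : ∀ k ∈ Λ, ‖p k‖ ≤ M) :
    |pair d Λ a p| ≤ (∑ k ∈ Λ, ‖a k‖) * M := by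
  refine (Complex.abs_re_le_norm _).trans ((norm_sum_le _ _).trans ?_)
  rw [Finset.sum_mul]
  refine Finset.sum_le_sum fun k hk => ?_
  rw [norm_mul, RCLike.norm_conj]
  exact mul_le_mul_of_nonneg_left (hM k hk) (norm_nonneg _)

/-- The coefficients of the constant polynomial `1`. -/
def oneCoeff (d : ℕ) : (Fin d → ℤ) → ℂ := Pi.single 0 1

lemma isCoeff_oneCoeff (h0 : 0 ∈ Λ) : IsCoeff d Λ (oneCoeff d) := by
  refine ⟨fun k hk => Pi.single_eq_of_ne (by rintro rfl; exact hk h0) _, fun k => ?_⟩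
  by_cases hk : k = 0
  · subst hk; simp [oneCoeff]
  · simp [oneCoeff, Pi.single_eq_of_ne, hk]

lemma eval_oneCoeff (h0 : 0 ∈ Λ) (θ : Fin d → ℝ) : eval d Λ (oneCoeff d) θ = 1 := by
  rw [eval, Finset.sum_eq_single_of_mem 0 h0]
  · simp [oneCoeff, dotP_zero_left]
  · intro k _ hk
    simp [oneCoeff, Pi.single_eq_of_ne hk]

lemma pair_oneCoeff (h0 : 0 ∈ Λ) (a : (Fin d → ℤ) → ℂ) :
    pair d Λ a (oneCoeff d) = (a 0).re := by
  rw [pair, Finset.sum_eq_single_of_mem 0 h0]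
  · simp [oneCoeff]
  · intro k _ hk
    simp [oneCoeff, Pi.single_eq_of_ne hk]

lemma norm_exp_add_exp_sub_two_le (u : ℝ) :
    ‖Complex.exp (-(u : ℂ) * Complex.I) + Complex.exp ((u : ℂ) * Complex.I) - 2‖ ≤ u ^ 2 := by
  have e : Complex.exp (-(u : ℂ) * Complex.I) + Complex.exp ((u : ℂ) * Complex.I) - 2 =
      ((2 * Real.cos u - 2 : ℝ) : ℂ) := by
    push_cast
    rw [Complex.two_cos]
    ring
  rw [e, Complex.norm_real, Real.norm_eq_abs, abs_le]
  constructor <;> nlinarith [Real.one_sub_sq_div_two_le_cos (x := u), Real.cos_le_one u, sq_nonneg u]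

lemma eval_add_add_eval_sub_le {M : ℝ} (hM : ∀ k ∈ Λ, ‖p k‖ ≤ M) (θ₀ x : Fin d → ℝ) :
    eval d Λ p (θ₀ + x) + eval d Λ p (θ₀ - x) - 2 * eval d Λ p θ₀ ≤
      (∑ k ∈ Λ, M * (∑ j, |(k j : ℝ)|) ^ 2) * ‖x‖ ^ 2 := by
  have e : eval d Λ p (θ₀ + x) + eval d Λ p (θ₀ - x) - 2 * eval d Λ p θ₀ =
      (∑ k ∈ Λ, p k * Complex.exp (-(dotP d k θ₀ : ℂ) * Complex.I) *
        (Complex.exp (-(dotP d k x : ℂ) * Complex.I) +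
          Complex.exp ((dotP d k x : ℂ) * Complex.I) - 2)).re := by
    simp only [eval]
    rw [← Complex.add_re, ← Complex.re_ofReal_mul,
      ← Complex.sub_re, Finset.mul_sum, ← Finset.sum_add_distrib, ← Finset.sum_sub_distrib]
    congr 1
    refine Finset.sum_congr rfl fun k _ => ?_
    rw [sub_eq_add_neg θ₀ x, dotP_add, dotP_add, dotP_neg]
    have e1 : Complex.exp (-((dotP d k θ₀ + dotP d k x : ℝ) : ℂ) * Complex.I) =
        Complex.exp (-(dotP d k θ₀ : ℂ) * Complex.I) *
          Complex.exp (-(dotP d k x : ℂ) * Complex.I) := by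
      rw [← Complex.exp_add]; push_cast; ring_nf
    have e2 : Complex.exp (-((dotP d k θ₀ + -dotP d k x : ℝ) : ℂ) * Complex.I) =
        Complex.exp (-(dotP d k θ₀ : ℂ) * Complex.I) *
          Complex.exp ((dotP d k x : ℂ) * Complex.I) := by
      rw [← Complex.exp_add]; push_cast; ring_nf
    rw [e1, e2]
    push_cast
    ring
  rw [e, Finset.sum_mul]
  refine (Complex.re_le_norm _).trans ((norm_sum_le _ _).trans (Finset.sum_le_sum fun k hk => ?_))
  rw [norm_mul, norm_mul, ← Complex.ofReal_neg, Complex.norm_exp_ofReal_mul_I, mul_one, mul_assoc,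
    ← mul_pow]
  have hM0 : 0 ≤ M := (norm_nonneg _).trans (hM k hk)
  refine mul_le_mul (hM k hk) ((norm_exp_add_exp_sub_two_le _).trans ?_) (norm_nonneg _) hM0
  exact sq_le_sq' (neg_le_of_abs_le (abs_dotP_le d k x)) (le_of_abs_le (abs_dotP_le d k x))

lemma integral_div_add_sq {m K : ℝ} (hm : 0 < m) (hK : 0 < K) :
    ∫ y in (0 : ℝ)..Real.pi, y * (m + K * y ^ 2)⁻¹ =
      (2 * K)⁻¹ * Real.log ((m + K * Real.pi ^ 2) / m) := by
  have hpos : ∀ y : ℝ, 0 < m + K * y ^ 2 := fun y => by positivity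
  have hd : ∀ y ∈ Set.uIcc 0 Real.pi,
      HasDerivAt (fun y => (2 * K)⁻¹ * Real.log (m + K * y ^ 2)) (y * (m + K * y ^ 2)⁻¹) y := by
    intro y _
    have h1 : HasDerivAt (fun y : ℝ => m + K * y ^ 2) (K * (2 * y)) y := by
      simpa using ((hasDerivAt_pow 2 y).const_mul K).const_add m
    have h2 := (h1.log (hpos y).ne').const_mul (2 * K)⁻¹
    convert! h2 using 1
    field_simp
  rw [intervalIntegral.integral_eq_sub_of_hasDerivAt hd]
  · rw [Real.log_div (hpos _).ne' hm.ne']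
    simp
    ring
  · refine Continuous.intervalIntegrable ?_ _ _
    exact continuous_id.mul (Continuous.inv₀ (by fun_prop) fun y => (hpos y).ne')

lemma setIntegral_Icc_fun_norm (hd : 1 ≤ d) (g : ℝ → ℝ) :
    ∫ x in Set.Icc (fun _ : Fin d => -Real.pi) (fun _ => Real.pi), g ‖x‖ =
      d • (volume.real (Metric.ball (0 : Fin d → ℝ) 1) *
        ∫ y in (0 : ℝ)..Real.pi, y ^ (d - 1) * g y) := by
  have : Nonempty (Fin d) := ⟨⟨0, hd⟩⟩
  have hset : Set.Icc (fun _ : Fin d => -Real.pi) (fun _ => Real.pi) =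
      {x : Fin d → ℝ | ‖x‖ ≤ Real.pi} := by
    ext x
    simp only [Set.mem_Icc, Pi.le_def, Set.mem_ofPred_eq, pi_norm_le_iff_of_nonneg Real.pi_pos.le,
      Real.norm_eq_abs, abs_le, forall_and]
  rw [← integral_indicator measurableSet_Icc, hset]
  have e : {x : Fin d → ℝ | ‖x‖ ≤ Real.pi}.indicator (fun x => g ‖x‖) =
      fun x => (Set.Iic Real.pi).indicator g ‖x‖ := by
    funext x
    simp [Set.indicator]
  rw [e, integral_fun_norm_addHaar, Module.finrank_fin_fun]
  simp only [smul_eq_mul, nsmul_eq_mul]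
  congr 2
  rw [intervalIntegral.integral_of_le Real.pi_pos.le, ← integral_indicator measurableSet_Ioi,
    ← integral_indicator measurableSet_Ioc]
  congr 1
  funext y
  simp only [Set.indicator, Set.mem_Ioi, Set.mem_Iic, Set.mem_Ioc]
  split_ifs <;> simp_all

lemma exists_mul_log_le_integral (hd1 : 1 ≤ d) (hd2 : d ≤ 2) {K : ℝ} (hK : 0 < K) :
    ∃ A > 0, ∀ m > 0, A * Real.log ((m + K * Real.pi ^ 2) / m) ≤
      ∫ x : Fin d → ℝ, (m + K * ‖x‖ ^ 2)⁻¹ ∂(dm d) := by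
  have hv : 0 < volume.real (Metric.ball (0 : Fin d → ℝ) 1) :=
    ENNReal.toReal_pos (Metric.measure_ball_pos _ _ one_pos).ne' measure_ball_lt_top.ne
  set v := volume.real (Metric.ball (0 : Fin d → ℝ) 1)
  have hdpos : (0 : ℝ) < d := by exact_mod_cast hd1
  have hpi := Real.pi_pos
  refine ⟨((2 * Real.pi) ^ d)⁻¹ * (d * (v * (Real.pi⁻¹ * (2 * K)⁻¹))), by positivity,
    fun m hm => ?_⟩
  have hpos : ∀ y : ℝ, 0 < m + K * y ^ 2 := fun y => by positivity
  rw [integral_dm, setIntegral_Icc_fun_norm hd1 fun y => (m + K * y ^ 2)⁻¹, smul_eq_mul,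
    nsmul_eq_mul, mul_assoc, mul_assoc, mul_assoc, mul_assoc, ← integral_div_add_sq hm hK]
  have hcont : Continuous fun y : ℝ => (m + K * y ^ 2)⁻¹ :=
    Continuous.inv₀ (by fun_prop) fun y => (hpos y).ne'
  gcongr
  rw [← intervalIntegral.integral_const_mul]
  refine intervalIntegral.integral_mono_on hpi.le ?_ ?_ fun y hy => ?_
  · exact Continuous.intervalIntegrable (by fun_prop) _ _
  · exact Continuous.intervalIntegrable (by fun_prop) _ _
  · rw [← mul_assoc]
    refine mul_le_mul_of_nonneg_right ?_ (inv_nonneg.2 (hpos y).le)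
    obtain rfl | rfl : d = 1 ∨ d = 2 := by omega
    · rw [pow_zero, inv_mul_le_iff₀ hpi]
      linarith [hy.2]
    · rw [pow_one, inv_mul_le_iff₀ hpi]
      nlinarith [hy.1, Real.pi_gt_three]

lemma continuous_inv_eval (hp : p ∈ Pplus d Λ) : Continuous fun θ => (eval d Λ p θ)⁻¹ :=
  (continuous_eval_right p).inv₀ fun θ => (eval_pos_of_mem_Pplus hp θ).ne'

/-- In dimension at most two, a bound on `∫ P⁻¹ dm` keeps positive polynomials with bounded
coefficients uniformly away from zero. -/
lemma exists_le_eval_of_integral_inv_le (hd1 : 1 ≤ d) (hd2 : d ≤ 2)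
    (hΛ : ∀ k ∈ Λ, -k ∈ Λ) (M C : ℝ) :
    ∃ η > 0, ∀ p ∈ Pplus d Λ, (p 0).re ≤ M → ∫ θ, (eval d Λ p θ)⁻¹ ∂(dm d) ≤ C →
      ∀ θ, η ≤ eval d Λ p θ := by
  set K : ℝ := 1 + ∑ k ∈ Λ, |M| * (∑ j, |(k j : ℝ)|) ^ 2 with hKdef
  have hK : 0 < K := by positivity
  obtain ⟨A, hA, hlog⟩ := exists_mul_log_le_integral hd1 hd2 hK
  have hpi := Real.pi_pos
  refine ⟨K * Real.pi ^ 2 / Real.exp (C / A), by positivity, fun p hp hpM hC θ => ?_⟩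
  have hpk : ∀ k ∈ Λ, ‖p k‖ ≤ |M| := fun k _ =>
    ((norm_le_of_mem_Pbar hΛ (mem_Pbar_of_mem_Pplus hp) k).trans hpM).trans (le_abs_self M)
  obtain ⟨θ₀, -, hmin⟩ := (isCompact_Icc (a := fun _ : Fin d => -Real.pi)
    (b := fun _ => Real.pi)).exists_isMinOn
      ⟨0, ⟨fun _ => by simpa using hpi.le, fun _ => hpi.le⟩⟩ (continuous_eval_right p).continuousOn
  have hmin' : ∀ θ, eval d Λ p θ₀ ≤ eval d Λ p θ := fun θ => by
    obtain ⟨θ', h', e⟩ := exists_mem_Td_eval_eq (Λ := Λ) p θ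
    rw [e]
    exact hmin ⟨fun j => (h' j trivial).1.le, fun j => (h' j trivial).2⟩
  refine le_trans ?_ (hmin' θ)
  set m := eval d Λ p θ₀ with hm
  have hm0 : 0 < m := eval_pos_of_mem_Pplus hp θ₀
  have hquad : ∀ x, eval d Λ p (θ₀ + x) ≤ m + K * ‖x‖ ^ 2 := fun x => by
    have := eval_add_add_eval_sub_le hpk θ₀ x
    have h2 := hmin' (θ₀ - x)
    nlinarith [sq_nonneg ‖x‖]
  have hpos : ∀ x : Fin d → ℝ, 0 < m + K * ‖x‖ ^ 2 := fun x => by positivity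
  have h1 : ∫ x : Fin d → ℝ, (m + K * ‖x‖ ^ 2)⁻¹ ∂(dm d) ≤ C := by
    rw [← integral_eval_add p (fun y => y⁻¹) θ₀ (continuous_inv_eval hp)] at hC
    refine le_trans (integral_mono ?_ ?_ fun x => ?_) hC
    · exact integrable_dm_of_continuous
        (Continuous.inv₀ (by fun_prop) fun x => (hpos x).ne')
    · exact integrable_dm_of_continuous ((continuous_inv_eval hp).comp (by fun_prop))
    · exact inv_anti₀ (eval_pos_of_mem_Pplus hp _) (hquad x)
  have h2 : Real.log ((m + K * Real.pi ^ 2) / m) ≤ C / A := by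
    rw [le_div_iff₀ hA, mul_comm]
    exact (hlog m hm0).trans h1
  rw [Real.log_le_iff_le_exp (by positivity), div_le_iff₀ hm0] at h2
  rw [div_le_iff₀ (Real.exp_pos _), mul_comm m]
  linarith

/-- The integrand `x log (x / y) - λ log x` of the regularized functional. -/
def integrand (lam x y : ℝ) : ℝ := x * Real.log (x / y) - lam * Real.log x

/-- The partial derivative of `integrand` in its first variable. -/
def integrandDerivFst (lam x y : ℝ) : ℝ := Real.log (x / y) + 1 - lam / x

lemma integrand_sub_tangent {lam x y x' y' : ℝ} (hx : 0 < x) (hy : 0 < y) (hx' : 0 < x')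
    (hy' : 0 < y') :
    integrand lam x' y' - (integrand lam x y +
      (integrandDerivFst lam x y * (x' - x) - x / y * (y' - y))) =
    x' * (y' * x / (x' * y) - 1 - Real.log (y' * x / (x' * y))) +
      lam * (x' / x - 1 - Real.log (x' / x)) := by
  simp only [integrand, integrandDerivFst]
  rw [Real.log_div hx'.ne' hy'.ne', Real.log_div hx.ne' hy.ne', Real.log_div hx'.ne' hx.ne',
    Real.log_div (by positivity) (by positivity), Real.log_mul hy'.ne' hx.ne',
    Real.log_mul hx'.ne' hy.ne']
  field_simp
  ring

lemma integrand_tangent_le {lam x y x' y' : ℝ} (hlam : 0 < lam) (hx : 0 < x) (hy : 0 < y)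
    (hx' : 0 < x') (hy' : 0 < y') :
    integrand lam x y + (integrandDerivFst lam x y * (x' - x) - x / y * (y' - y)) ≤
      integrand lam x' y' := by
  rw [← sub_nonneg, integrand_sub_tangent hx hy hx' hy']
  have h1 := Real.log_le_sub_one_of_pos (show 0 < y' * x / (x' * y) by positivity)
  have h2 := Real.log_le_sub_one_of_pos (show 0 < x' / x by positivity)
  exact add_nonneg (mul_nonneg hx'.le (by linarith)) (mul_nonneg hlam.le (by linarith))

lemma eq_of_integrand_eq_tangent {lam x y x' y' : ℝ} (hlam : 0 < lam) (hx : 0 < x) (hy : 0 < y)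
    (hx' : 0 < x') (hy' : 0 < y')
    (h : integrand lam x y + (integrandDerivFst lam x y * (x' - x) - x / y * (y' - y)) =
      integrand lam x' y') : x' = x ∧ y' = y := by
  rw [← sub_eq_zero, ← neg_eq_zero, neg_sub, integrand_sub_tangent hx hy hx' hy'] at h
  have h1 := Real.log_le_sub_one_of_pos (show 0 < y' * x / (x' * y) by positivity)
  have h2 := Real.log_le_sub_one_of_pos (show 0 < x' / x by positivity)
  rw [add_eq_zero_iff_of_nonneg (mul_nonneg hx'.le (by linarith))
    (mul_nonneg hlam.le (by linarith)), mul_eq_zero, mul_eq_zero] at h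
  have e2 : x' / x = 1 := by
    by_contra hne
    have := Real.log_lt_sub_one_of_pos (by positivity) hne
    rcases h.2 with h | h <;> linarith
  have e1 : y' * x / (x' * y) = 1 := by
    by_contra hne
    have := Real.log_lt_sub_one_of_pos (by positivity) hne
    rcases h.1 with h | h <;> linarith
  rw [div_eq_one_iff_eq hx.ne'] at e2
  rw [div_eq_one_iff_eq (by positivity), e2, mul_comm] at e1
  exact ⟨e2, mul_left_cancel₀ hx.ne' e1⟩

/-- The directional derivative of `Jlam` at `(P, Q)` in the direction `(H, G)`. -/
def dirDeriv (d : ℕ) (Λ : Finset (Fin d → ℤ)) (c γ : (Fin d → ℤ) → ℂ) (lam : ℝ)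
    (P Q H G : (Fin d → ℤ) → ℂ) : ℝ :=
  pair d Λ c G - pair d Λ γ H +
    ∫ θ, (integrandDerivFst lam (eval d Λ P θ) (eval d Λ Q θ) * eval d Λ H θ -
      eval d Λ P θ / eval d Λ Q θ * eval d Λ G θ) ∂(dm d)

variable {c γ P Q P' Q' H G : (Fin d → ℤ) → ℂ} {lam : ℝ}

lemma continuous_log_eval_div {X : Type*} [TopologicalSpace X] {f g : X → ℝ} (hf : Continuous f)
    (hg : Continuous g) (hf0 : ∀ x, 0 < f x) (hg0 : ∀ x, 0 < g x) :
    Continuous fun x => Real.log (f x / g x) :=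
  (hf.div hg fun x => (hg0 x).ne').log fun x => (div_pos (hf0 x) (hg0 x)).ne'

lemma continuous_integrand {X : Type*} [TopologicalSpace X] {f g : X → ℝ} (hf : Continuous f)
    (hg : Continuous g) (hf0 : ∀ x, 0 < f x) (hg0 : ∀ x, 0 < g x) :
    Continuous fun x => integrand lam (f x) (g x) :=
  (hf.mul (continuous_log_eval_div hf hg hf0 hg0)).sub
    (continuous_const.mul (hf.log fun x => (hf0 x).ne'))

lemma continuous_integrandDerivFst {X : Type*} [TopologicalSpace X] {f g : X → ℝ}
    (hf : Continuous f) (hg : Continuous g) (hf0 : ∀ x, 0 < f x) (hg0 : ∀ x, 0 < g x) :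
    Continuous fun x => integrandDerivFst lam (f x) (g x) :=
  ((continuous_log_eval_div hf hg hf0 hg0).add continuous_const).sub
    (continuous_const.div hf fun x => (hf0 x).ne')

lemma continuous_eval_div_eval (P : (Fin d → ℤ) → ℂ) (hQ : Q ∈ Pplus d Λ) :
    Continuous fun θ => eval d Λ P θ / eval d Λ Q θ :=
  (continuous_eval_right P).div (continuous_eval_right Q)
    fun θ => (eval_pos_of_mem_Pplus hQ θ).ne'

lemma continuous_integrand_eval (hP : P ∈ Pplus d Λ) (hQ : Q ∈ Pplus d Λ) :
    Continuous fun θ => integrand lam (eval d Λ P θ) (eval d Λ Q θ) :=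
  continuous_integrand (continuous_eval_right P) (continuous_eval_right Q)
    (eval_pos_of_mem_Pplus hP) (eval_pos_of_mem_Pplus hQ)

lemma continuous_integrandDerivFst_eval (hP : P ∈ Pplus d Λ) (hQ : Q ∈ Pplus d Λ) :
    Continuous fun θ => integrandDerivFst lam (eval d Λ P θ) (eval d Λ Q θ) :=
  continuous_integrandDerivFst (continuous_eval_right P) (continuous_eval_right Q)
    (eval_pos_of_mem_Pplus hP) (eval_pos_of_mem_Pplus hQ)

lemma continuous_dirDeriv_integrand (hP : P ∈ Pplus d Λ) (hQ : Q ∈ Pplus d Λ)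
    (H G : (Fin d → ℤ) → ℂ) :
    Continuous fun θ => integrandDerivFst lam (eval d Λ P θ) (eval d Λ Q θ) * eval d Λ H θ -
      eval d Λ P θ / eval d Λ Q θ * eval d Λ G θ :=
  ((continuous_integrandDerivFst_eval hP hQ).mul (continuous_eval_right H)).sub
    ((continuous_eval_div_eval P hQ).mul (continuous_eval_right G))

lemma Jlam_eq (hP : P ∈ Pplus d Λ) (hQ : Q ∈ Pplus d Λ) :
    Jlam d Λ c γ lam P Q = pair d Λ c Q - pair d Λ γ P +
      ∫ θ, integrand lam (eval d Λ P θ) (eval d Λ Q θ) ∂(dm d) := by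
  simp only [Jlam, integrand]
  rw [integral_sub, integral_const_mul]
  · ring
  · exact integrable_dm_of_continuous ((continuous_eval_right P).mul
      (continuous_log_eval_div (continuous_eval_right P) (continuous_eval_right Q)
        (eval_pos_of_mem_Pplus hP) (eval_pos_of_mem_Pplus hQ)))
  · exact integrable_dm_of_continuous (continuous_const.mul
      ((continuous_eval_right P).log fun θ => (eval_pos_of_mem_Pplus hP θ).ne'))

lemma dirDeriv_smul (t : ℝ) (P Q H G : (Fin d → ℤ) → ℂ) :
    dirDeriv d Λ c γ lam P Q (t • H) (t • G) = t * dirDeriv d Λ c γ lam P Q H G := by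
  simp only [dirDeriv, pair_smul, eval_smul]
  rw [mul_add, ← integral_const_mul, mul_sub]
  congr 2
  funext θ
  ring

lemma Jlam_sub_tangent (hP : P ∈ Pplus d Λ) (hQ : Q ∈ Pplus d Λ) (hP' : P' ∈ Pplus d Λ)
    (hQ' : Q' ∈ Pplus d Λ) :
    Jlam d Λ c γ lam P' Q' -
      (Jlam d Λ c γ lam P Q + dirDeriv d Λ c γ lam P Q (P' - P) (Q' - Q)) =
    ∫ θ, (integrand lam (eval d Λ P' θ) (eval d Λ Q' θ) -
      (integrand lam (eval d Λ P θ) (eval d Λ Q θ) +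
        (integrandDerivFst lam (eval d Λ P θ) (eval d Λ Q θ) *
          (eval d Λ P' θ - eval d Λ P θ) -
          eval d Λ P θ / eval d Λ Q θ * (eval d Λ Q' θ - eval d Λ Q θ)))) ∂(dm d) := by
  have i1 := integrable_dm_of_continuous (continuous_integrand_eval (lam := lam) hP hQ)
  have i2 := integrable_dm_of_continuous (continuous_integrand_eval (lam := lam) hP' hQ')
  have i3 := integrable_dm_of_continuous
    (continuous_dirDeriv_integrand (lam := lam) hP hQ (P' - P) (Q' - Q))
  simp only [← eval_sub]
  have i4 := integral_sub i2 (i1.add i3)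
  simp only [Pi.add_apply] at i4
  rw [Jlam_eq hP hQ, Jlam_eq hP' hQ', dirDeriv, i4, integral_add i1 i3, pair_sub, pair_sub]
  ring

lemma Jlam_tangent_le (hlam : 0 < lam) (hP : P ∈ Pplus d Λ) (hQ : Q ∈ Pplus d Λ)
    (hP' : P' ∈ Pplus d Λ) (hQ' : Q' ∈ Pplus d Λ) :
    Jlam d Λ c γ lam P Q + dirDeriv d Λ c γ lam P Q (P' - P) (Q' - Q) ≤
      Jlam d Λ c γ lam P' Q' := by
  rw [← sub_nonneg, Jlam_sub_tangent hP hQ hP' hQ']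
  exact integral_nonneg fun θ => sub_nonneg.2 (integrand_tangent_le hlam
    (eval_pos_of_mem_Pplus hP θ) (eval_pos_of_mem_Pplus hQ θ) (eval_pos_of_mem_Pplus hP' θ)
    (eval_pos_of_mem_Pplus hQ' θ))

lemma Jlam_tangent_lt (hΛ : ∀ k ∈ Λ, -k ∈ Λ) (hlam : 0 < lam) (hP : P ∈ Pplus d Λ)
    (hQ : Q ∈ Pplus d Λ) (hP' : P' ∈ Pplus d Λ) (hQ' : Q' ∈ Pplus d Λ)
    (hne : ¬(P' = P ∧ Q' = Q)) :
    Jlam d Λ c γ lam P Q + dirDeriv d Λ c γ lam P Q (P' - P) (Q' - Q) <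
      Jlam d Λ c γ lam P' Q' := by
  refine lt_of_le_of_ne (Jlam_tangent_le hlam hP hQ hP' hQ') fun heq => hne ?_
  have h := Jlam_sub_tangent (c := c) (γ := γ) (lam := lam) hP hQ hP' hQ'
  rw [heq, sub_self, eq_comm, integral_eq_zero_iff_of_nonneg] at h
  · have hae : ∀ᵐ θ ∂(dm d), eval d Λ P' θ = eval d Λ P θ ∧ eval d Λ Q' θ = eval d Λ Q θ := by
      filter_upwards [h] with θ hθ
      exact eq_of_integrand_eq_tangent hlam (eval_pos_of_mem_Pplus hP θ)
        (eval_pos_of_mem_Pplus hQ θ) (eval_pos_of_mem_Pplus hP' θ) (eval_pos_of_mem_Pplus hQ' θ)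
        (sub_eq_zero.1 hθ).symm
    exact ⟨hP'.1.eq_of_ae_eq hΛ hP.1 (hae.mono fun _ h => h.1),
      hQ'.1.eq_of_ae_eq hΛ hQ.1 (hae.mono fun _ h => h.2)⟩
  · exact fun θ => sub_nonneg.2 (integrand_tangent_le hlam
      (eval_pos_of_mem_Pplus hP θ) (eval_pos_of_mem_Pplus hQ θ) (eval_pos_of_mem_Pplus hP' θ)
      (eval_pos_of_mem_Pplus hQ' θ))
  · have i3 := continuous_dirDeriv_integrand (lam := lam) hP hQ (P' - P) (Q' - Q)
    simp only [eval_sub] at i3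
    exact integrable_dm_of_continuous ((continuous_integrand_eval hP' hQ').sub
      ((continuous_integrand_eval hP hQ).add i3))

lemma convex_Pplus : Convex ℝ (Pplus d Λ) := by
  intro p hp q hq a b ha hb hab
  refine ⟨(hp.1.smul a).add (hq.1.smul b), fun θ hθ => ?_⟩
  rw [eval_add, eval_smul, eval_smul]
  have h1 := hp.2 θ hθ
  have h2 := hq.2 θ hθ
  rcases ha.eq_or_lt with rfl | ha
  · rw [zero_add] at hab; subst hab; linarith
  · have := mul_pos ha h1
    have := mul_nonneg hb h2.le
    linarith

lemma convex_Ppluso : Convex ℝ (Ppluso d Λ) := by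
  intro p hp q hq a b ha hb hab
  refine ⟨convex_Pplus hp.1 hq.1 ha hb hab, ?_⟩
  simp only [Pi.add_apply, Pi.smul_apply, hp.2, hq.2, ← add_smul, hab, one_smul]

lemma strictConvexOn_Jlam (hΛ : ∀ k ∈ Λ, -k ∈ Λ) (hlam : 0 < lam) :
    StrictConvexOn ℝ (Ppluso d Λ ×ˢ Pplus d Λ)
      (fun PQ : ((Fin d → ℤ) → ℂ) × ((Fin d → ℤ) → ℂ) => Jlam d Λ c γ lam PQ.1 PQ.2) := by
  refine ⟨convex_Ppluso.prod convex_Pplus, ?_⟩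
  rintro ⟨P₁, Q₁⟩ ⟨hP₁, hQ₁⟩ ⟨P₂, Q₂⟩ ⟨hP₂, hQ₂⟩ hne a b ha hb hab
  simp only [Prod.smul_mk, Prod.mk_add_mk, smul_eq_mul]
  have hP := convex_Pplus hP₁.1 hP₂.1 ha.le hb.le hab
  have hQ := convex_Pplus hQ₁ hQ₂ ha.le hb.le hab
  have e1 : ∀ x y : (Fin d → ℤ) → ℂ, x - (a • x + b • y) = b • (x - y) := fun x y => by
    obtain rfl : a = 1 - b := by linarith
    module
  have e2 : ∀ x y : (Fin d → ℤ) → ℂ, y - (a • x + b • y) = (-a) • (x - y) := fun x y => by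
    obtain rfl : b = 1 - a := by linarith
    module
  have h1 := Jlam_tangent_lt (c := c) (γ := γ) hΛ hlam hP hQ hP₁.1 hQ₁ (by
    rintro ⟨h, h'⟩
    rw [← sub_eq_zero, e1, smul_eq_zero_iff_right hb.ne', sub_eq_zero] at h h'
    exact hne (Prod.ext h h'))
  have h2 := Jlam_tangent_le (c := c) (γ := γ) hlam hP hQ hP₂.1 hQ₂
  rw [e1, e1, dirDeriv_smul] at h1
  rw [e2, e2, dirDeriv_smul] at h2
  set X := Jlam d Λ c γ lam (a • P₁ + b • P₂) (a • Q₁ + b • Q₂)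
  set D := dirDeriv d Λ c γ lam (a • P₁ + b • P₂) (a • Q₁ + b • Q₂) (P₁ - P₂) (Q₁ - Q₂)
  have h3 := mul_lt_mul_of_pos_left h1 ha
  have h4 := mul_le_mul_of_nonneg_left h2 hb.le
  have h5 : X = a * (X + b * D) + b * (X + -a * D) := by
    have : b = 1 - a := by linarith
    rw [this]; ring
  linarith

lemma isClosed_isCoeff : IsClosed {p : (Fin d → ℤ) → ℂ | IsCoeff d Λ p} := by
  simp only [IsCoeff, Set.ofPred_and, Set.ofPred_forall]
  refine IsClosed.inter ?_ ?_
  · exact isClosed_iInter fun k => isClosed_iInter fun _ =>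
      isClosed_eq (continuous_apply k) continuous_const
  · exact isClosed_iInter fun k =>
      isClosed_eq (continuous_apply _) (Complex.continuous_conj.comp (continuous_apply k))

lemma isCompact_normalized_Pbar (hΛ : ∀ k ∈ Λ, -k ∈ Λ) :
    IsCompact {p | p ∈ Pbar d Λ ∧ p 0 = 1} := by
  refine IsCompact.of_isClosed_subset
    (isCompact_univ_pi fun _ : Fin d → ℤ => isCompact_closedBall (0 : ℂ) 1) ?_ ?_
  · simp only [Pbar, Set.ofPred_and, Set.ofPred_forall]
    refine (isClosed_isCoeff.inter ?_).inter (isClosed_eq (continuous_apply _) continuous_const)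
    exact isClosed_iInter fun θ => isClosed_iInter fun _ =>
      isClosed_le continuous_const (continuous_eval.comp (by fun_prop : Continuous fun p => (p, θ)))
  · rintro p ⟨hp, hp0⟩ k -
    have := norm_le_of_mem_Pbar hΛ hp k
    simpa [hp0] using this

lemma oneCoeff_mem_Pplus (h0 : 0 ∈ Λ) : oneCoeff d ∈ Pplus d Λ :=
  ⟨isCoeff_oneCoeff h0, fun θ _ => by rw [eval_oneCoeff h0]; exact one_pos⟩

lemma exists_mul_le_pair (h0 : 0 ∈ Λ) (hΛ : ∀ k ∈ Λ, -k ∈ Λ) (hc : c ∈ Cplus d Λ) :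
    ∃ κ > 0, ∀ q ∈ Pbar d Λ, κ * (q 0).re ≤ pair d Λ c q := by
  obtain ⟨p, ⟨hp, hp0⟩, hmin⟩ := (isCompact_normalized_Pbar hΛ).exists_isMinOn
    ⟨oneCoeff d, mem_Pbar_of_mem_Pplus (oneCoeff_mem_Pplus h0), by simp [oneCoeff]⟩
    (continuous_pair c).continuousOn
  refine ⟨pair d Λ c p, hc.2 p hp (by rintro rfl; simp at hp0), fun q hq => ?_⟩
  rcases ((norm_nonneg _).trans (norm_le_of_mem_Pbar hΛ hq 0)).eq_or_lt with h | h
  · have hq0 : q = 0 := funext fun k => by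
      have := norm_le_of_mem_Pbar hΛ hq k
      rw [← h] at this
      exact norm_le_zero_iff.1 this
    simp [hq0, pair]
  · have hmem : ((q 0).re⁻¹ • q) ∈ {p | p ∈ Pbar d Λ ∧ p 0 = 1} := by
      refine ⟨⟨hq.1.smul _, fun θ hθ => ?_⟩, ?_⟩
      · rw [eval_smul]
        exact mul_nonneg (inv_nonneg.2 h.le) (hq.2 θ hθ)
      · rw [Pi.smul_apply, ← hq.1.ofReal_re_zero, Complex.real_smul, ← Complex.ofReal_mul,
          Complex.ofReal_re, inv_mul_cancel₀ h.ne', Complex.ofReal_one]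
    have := hmin hmem
    simp only [Set.mem_ofPred_eq, pair_smul] at this
    rwa [le_inv_mul_iff₀ h, mul_comm] at this

/-- Pairs `(P, Q)` bounded below by `δ`, with `p₀ = 1` and `q₀ ≤ B`. -/
def boxed (d : ℕ) (Λ : Finset (Fin d → ℤ)) (δ B : ℝ) :
    Set (((Fin d → ℤ) → ℂ) × ((Fin d → ℤ) → ℂ)) :=
  {x | IsCoeff d Λ x.1 ∧ IsCoeff d Λ x.2 ∧ x.1 0 = 1 ∧ (x.2 0).re ≤ B ∧
    ∀ θ, δ ≤ eval d Λ x.1 θ ∧ δ ≤ eval d Λ x.2 θ}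

variable {δ B : ℝ} {x y : ((Fin d → ℤ) → ℂ) × ((Fin d → ℤ) → ℂ)}

lemma fst_mem_Pplus_of_mem_boxed (hδ : 0 < δ) (hx : x ∈ boxed d Λ δ B) : x.1 ∈ Pplus d Λ :=
  ⟨hx.1, fun θ _ => hδ.trans_le (hx.2.2.2.2 θ).1⟩

lemma snd_mem_Pplus_of_mem_boxed (hδ : 0 < δ) (hx : x ∈ boxed d Λ δ B) : x.2 ∈ Pplus d Λ :=
  ⟨hx.2.1, fun θ _ => hδ.trans_le (hx.2.2.2.2 θ).2⟩

lemma convex_boxed : Convex ℝ (boxed d Λ δ B) := by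
  rintro x ⟨hx1, hx2, hx3, hx4, hx5⟩ y ⟨hy1, hy2, hy3, hy4, hy5⟩ a b ha hb hab
  have key : ∀ {u v w : ℝ}, w ≤ u → w ≤ v → w ≤ a * u + b * v := fun {u v w} hu hv => by
    obtain rfl : b = 1 - a := by linarith
    nlinarith
  refine ⟨(hx1.smul a).add (hy1.smul b), (hx2.smul a).add (hy2.smul b), ?_, ?_, fun θ => ?_⟩
  · simp only [Prod.fst_add, Prod.smul_fst, Pi.add_apply, Pi.smul_apply, hx3, hy3, ← add_smul, hab,
      one_smul]
  · simp only [Prod.snd_add, Prod.smul_snd, Pi.add_apply, Pi.smul_apply, Complex.add_re,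
      Complex.smul_re, smul_eq_mul]
    have := key (neg_le_neg hx4) (neg_le_neg hy4)
    linarith
  · simp only [Prod.fst_add, Prod.smul_fst, Prod.snd_add, Prod.smul_snd, eval_add, eval_smul]
    exact ⟨key (hx5 θ).1 (hy5 θ).1, key (hx5 θ).2 (hy5 θ).2⟩

lemma isCompact_boxed (hΛ : ∀ k ∈ Λ, -k ∈ Λ) (hδ : 0 < δ) : IsCompact (boxed d Λ δ B) := by
  refine IsCompact.of_isClosed_subset
    ((isCompact_univ_pi fun _ : Fin d → ℤ => isCompact_closedBall (0 : ℂ) 1).prod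
      (isCompact_univ_pi fun _ : Fin d → ℤ => isCompact_closedBall (0 : ℂ) B)) ?_ ?_
  · simp only [boxed, Set.ofPred_and, Set.ofPred_forall]
    refine (isClosed_isCoeff.preimage continuous_fst).inter
      ((isClosed_isCoeff.preimage continuous_snd).inter (IsClosed.inter ?_ (IsClosed.inter ?_ ?_)))
    · exact isClosed_eq (by fun_prop) continuous_const
    · exact isClosed_le (by fun_prop) continuous_const
    · refine isClosed_iInter fun θ => IsClosed.inter ?_ ?_
      · exact isClosed_le continuous_const (continuous_eval.comp (continuous_fst.prodMk
          continuous_const))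
      · exact isClosed_le continuous_const (continuous_eval.comp (continuous_snd.prodMk
          continuous_const))
  · intro x hx
    refine ⟨fun k _ => ?_, fun k _ => ?_⟩
    · have := norm_le_of_mem_Pbar hΛ (mem_Pbar_of_mem_Pplus (fst_mem_Pplus_of_mem_boxed hδ hx)) k
      simpa [hx.2.2.1] using this
    · have := norm_le_of_mem_Pbar hΛ (mem_Pbar_of_mem_Pplus (snd_mem_Pplus_of_mem_boxed hδ hx)) k
      simpa using this.trans hx.2.2.2.1

lemma continuousOn_Jlam_boxed (hΛ : ∀ k ∈ Λ, -k ∈ Λ) (hδ : 0 < δ) :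
    ContinuousOn (fun x : ((Fin d → ℤ) → ℂ) × ((Fin d → ℤ) → ℂ) => Jlam d Λ c γ lam x.1 x.2)
      (boxed d Λ δ B) := by
  rw [continuousOn_iff_continuous_domRestrict]
  have : CompactSpace (boxed d Λ δ B) := isCompact_iff_compactSpace.1 (isCompact_boxed hΛ hδ)
  have e : (boxed d Λ δ B).domRestrict (fun x => Jlam d Λ c γ lam x.1 x.2) =
      fun x : boxed d Λ δ B => pair d Λ c x.1.2 - pair d Λ γ x.1.1 +
        ∫ θ, integrand lam (eval d Λ x.1.1 θ) (eval d Λ x.1.2 θ) ∂(dm d) := by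
    funext x
    exact Jlam_eq (fst_mem_Pplus_of_mem_boxed hδ x.2) (snd_mem_Pplus_of_mem_boxed hδ x.2)
  rw [e]
  refine (((continuous_pair c).comp (by fun_prop)).sub
    ((continuous_pair γ).comp (by fun_prop))).add (continuous_integral_dm ?_)
  refine continuous_integrand (f := fun z : boxed d Λ δ B × (Fin d → ℝ) => eval d Λ z.1.1.1 z.2)
    (g := fun z => eval d Λ z.1.1.2 z.2) ?_ ?_ (fun z => ?_) fun z => ?_
  · exact continuous_eval.comp (by fun_prop :
      Continuous fun z : boxed d Λ δ B × (Fin d → ℝ) => (z.1.1.1, z.2))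
  · exact continuous_eval.comp (by fun_prop :
      Continuous fun z : boxed d Λ δ B × (Fin d → ℝ) => (z.1.1.2, z.2))
  · exact hδ.trans_le (z.1.2.2.2.2.2 z.2).1
  · exact hδ.trans_le (z.1.2.2.2.2.2 z.2).2

lemma continuous_dirDeriv_segment (hδ : 0 < δ) (hx : x ∈ boxed d Λ δ B)
    (hy : y ∈ boxed d Λ δ B) (H G : (Fin d → ℤ) → ℂ) :
    Continuous fun t : Set.Icc (0 : ℝ) 1 =>
      dirDeriv d Λ c γ lam (x.1 + t.1 • (y.1 - x.1)) (x.2 + t.1 • (y.2 - x.2)) H G := by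
  have hmem : ∀ t : Set.Icc (0 : ℝ) 1, x + t.1 • (y - x) ∈ boxed d Λ δ B := fun t =>
    convex_boxed.add_smul_sub_mem hx hy t.2
  refine continuous_const.add (continuous_integral_dm ?_)
  have h1 : Continuous fun z : Set.Icc (0 : ℝ) 1 × (Fin d → ℝ) =>
      eval d Λ (x.1 + z.1.1 • (y.1 - x.1)) z.2 :=
    continuous_eval.comp (by fun_prop :
      Continuous fun z : Set.Icc (0 : ℝ) 1 × (Fin d → ℝ) => (x.1 + z.1.1 • (y.1 - x.1), z.2))
  have h2 : Continuous fun z : Set.Icc (0 : ℝ) 1 × (Fin d → ℝ) =>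
      eval d Λ (x.2 + z.1.1 • (y.2 - x.2)) z.2 :=
    continuous_eval.comp (by fun_prop :
      Continuous fun z : Set.Icc (0 : ℝ) 1 × (Fin d → ℝ) => (x.2 + z.1.1 • (y.2 - x.2), z.2))
  have h1' : ∀ z : Set.Icc (0 : ℝ) 1 × (Fin d → ℝ),
      0 < eval d Λ (x.1 + z.1.1 • (y.1 - x.1)) z.2 := fun z =>
    hδ.trans_le ((hmem z.1).2.2.2.2 z.2).1
  have h2' : ∀ z : Set.Icc (0 : ℝ) 1 × (Fin d → ℝ),
      0 < eval d Λ (x.2 + z.1.1 • (y.2 - x.2)) z.2 := fun z =>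
    hδ.trans_le ((hmem z.1).2.2.2.2 z.2).2
  exact ((continuous_integrandDerivFst h1 h2 h1' h2').mul
    ((continuous_eval_right H).comp continuous_snd)).sub
    ((h1.div h2 fun z => (h2' z).ne').mul ((continuous_eval_right G).comp continuous_snd))

lemma dirDeriv_nonneg_of_isMinOn (hlam : 0 < lam) (hδ : 0 < δ) (hx : x ∈ boxed d Λ δ B)
    (hmin : ∀ y ∈ boxed d Λ δ B, Jlam d Λ c γ lam x.1 x.2 ≤ Jlam d Λ c γ lam y.1 y.2)
    (hy : y ∈ boxed d Λ δ B) :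
    0 ≤ dirDeriv d Λ c γ lam x.1 x.2 (y.1 - x.1) (y.2 - x.2) := by
  have hcont := continuous_dirDeriv_segment (c := c) (γ := γ) (lam := lam) hδ hx hy
    (y.1 - x.1) (y.2 - x.2)
  set f : Set.Icc (0 : ℝ) 1 → ℝ := fun t =>
    dirDeriv d Λ c γ lam (x.1 + t.1 • (y.1 - x.1)) (x.2 + t.1 • (y.2 - x.2))
      (y.1 - x.1) (y.2 - x.2) with hf
  have hpos : ∀ t : Set.Icc (0 : ℝ) 1, 0 < t.1 → 0 ≤ f t := fun t ht => by
    have hmem : x + t.1 • (y - x) ∈ boxed d Λ δ B := convex_boxed.add_smul_sub_mem hx hy t.2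
    have h1 := Jlam_tangent_le (c := c) (γ := γ) hlam (fst_mem_Pplus_of_mem_boxed hδ hmem)
      (snd_mem_Pplus_of_mem_boxed hδ hmem) (fst_mem_Pplus_of_mem_boxed hδ hx)
      (snd_mem_Pplus_of_mem_boxed hδ hx)
    have e1 : x.1 - (x + t.1 • (y - x)).1 = (-t.1) • (y.1 - x.1) := by
      simp only [Prod.fst_add, Prod.smul_fst, Prod.fst_sub]; module
    have e2 : x.2 - (x + t.1 • (y - x)).2 = (-t.1) • (y.2 - x.2) := by
      simp only [Prod.snd_add, Prod.smul_snd, Prod.snd_sub]; module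
    rw [e1, e2, dirDeriv_smul] at h1
    have h2 := hmin _ hmem
    have h3 : -t.1 * f t ≤ 0 := by
      simp only [hf]
      simp only [Prod.fst_add, Prod.smul_fst, Prod.fst_sub, Prod.snd_add, Prod.smul_snd,
        Prod.snd_sub] at h1 h2
      linarith
    by_contra! hneg
    nlinarith
  let u : ℕ → Set.Icc (0 : ℝ) 1 := fun n =>
    ⟨1 / ((n : ℝ) + 1), by positivity, by
      rw [div_le_one (by positivity)]; linarith [n.cast_nonneg (α := ℝ)]⟩
  have hu : Filter.Tendsto u Filter.atTop (nhds ⟨0, by simp⟩) := by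
    rw [tendsto_subtype_rng]
    exact tendsto_one_div_add_atTop_nhds_zero_nat
  have h0 : 0 ≤ f ⟨0, by simp⟩ :=
    ge_of_tendsto' ((hcont.tendsto _).comp hu) fun n => hpos (u n) (by positivity)
  simpa [hf] using h0

lemma pair_add_integral_div_le (h0 : 0 ∈ Λ) (hΛ : ∀ k ∈ Λ, -k ∈ Λ) (hP : P ∈ Pplus d Λ)
    (hP0 : P 0 = 1) (hQ : Q ∈ Pplus d Λ)
    (h : 0 ≤ dirDeriv d Λ c γ lam P Q (P - P) (oneCoeff d - Q)) :
    pair d Λ c Q + ∫ θ, eval d Λ P θ / eval d Λ Q θ ∂(dm d) ≤ (c 0).re + 1 := by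
  have e : ∫ θ, (integrandDerivFst lam (eval d Λ P θ) (eval d Λ Q θ) * eval d Λ (P - P) θ -
      eval d Λ P θ / eval d Λ Q θ * eval d Λ (oneCoeff d - Q) θ) ∂(dm d) =
      1 - ∫ θ, eval d Λ P θ / eval d Λ Q θ ∂(dm d) := by
    have hI : ∫ θ, eval d Λ P θ ∂(dm d) = 1 := by
      rw [hP.1.integral_eval hΛ, hP0, Complex.one_re]
    rw [← hI, ← integral_sub (integrable_dm_of_continuous (continuous_eval_right P))
      (integrable_dm_of_continuous (continuous_eval_div_eval P hQ))]
    congr 1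
    funext θ
    have := (eval_pos_of_mem_Pplus hQ θ).ne'
    rw [eval_sub, eval_sub, eval_oneCoeff h0]
    field_simp
    ring
  rw [dirDeriv, e, pair_sub, pair_sub, pair_oneCoeff h0] at h
  linarith

lemma integrandDerivFst_mul_le {x y : ℝ} (hx : 0 < x) (hy : 0 < y) :
    integrandDerivFst lam x y * (1 - x) ≤
      x / y + y + (-2 * x) + lam - lam * x⁻¹ := by
  have h1 := Real.log_le_sub_one_of_pos (div_pos hx hy)
  have h2 := mul_le_mul_of_nonneg_left (Real.log_le_sub_one_of_pos (div_pos hy hx)) hx.le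
  have h3 : Real.log (y / x) = -Real.log (x / y) := by rw [← Real.log_inv, inv_div]
  have h4 : x * (y / x - 1) = y - x := by field_simp
  have h5 : lam / x * (1 - x) = lam * x⁻¹ - lam := by field_simp
  rw [h3, h4] at h2
  rw [integrandDerivFst, sub_mul, h5]
  linarith

lemma mul_integral_inv_le (h0 : 0 ∈ Λ) (hΛ : ∀ k ∈ Λ, -k ∈ Λ) (hγ0 : γ 0 = 1)
    (hP : P ∈ Pplus d Λ) (hP0 : P 0 = 1) (hQ : Q ∈ Pplus d Λ)
    (h : 0 ≤ dirDeriv d Λ c γ lam P Q (oneCoeff d - P) (Q - Q)) :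
    lam * ∫ θ, (eval d Λ P θ)⁻¹ ∂(dm d) ≤
      lam + (∑ k ∈ Λ, ‖γ k‖) + (∫ θ, eval d Λ P θ / eval d Λ Q θ ∂(dm d)) + (Q 0).re := by
  have i1 := integrable_dm_of_continuous (continuous_eval_div_eval P hQ)
  have i2 := integrable_dm_of_continuous (continuous_eval_right (Λ := Λ) Q)
  have i3 := (integrable_dm_of_continuous (continuous_eval_right (Λ := Λ) P)).const_mul (-2)
  have i4 := (integrable_dm_of_continuous (continuous_inv_eval hP)).const_mul lam
  have i5 : Integrable (fun _ : Fin d → ℝ => lam) (dm d) := integrable_const lam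
  have hle : ∫ θ, (integrandDerivFst lam (eval d Λ P θ) (eval d Λ Q θ) *
      eval d Λ (oneCoeff d - P) θ - eval d Λ P θ / eval d Λ Q θ * eval d Λ (Q - Q) θ) ∂(dm d) ≤
      ∫ θ, (eval d Λ P θ / eval d Λ Q θ + eval d Λ Q θ + (-2 * eval d Λ P θ) + lam -
        lam * (eval d Λ P θ)⁻¹) ∂(dm d) := by
    refine integral_mono (integrable_dm_of_continuous (continuous_dirDeriv_integrand hP hQ _ _))
      ((((i1.add i2).add i3).add i5).sub i4) fun θ => ?_
    simp only [sub_self, eval_zero, eval_sub, mul_zero, sub_zero, eval_oneCoeff h0]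
    exact integrandDerivFst_mul_le (eval_pos_of_mem_Pplus hP θ) (eval_pos_of_mem_Pplus hQ θ)
  have e1 := integral_sub (((i1.add i2).add i3).add i5) i4
  have e2 := integral_add ((i1.add i2).add i3) i5
  have e3 := integral_add (i1.add i2) i3
  simp only [Pi.add_apply] at e1 e2 e3
  rw [e1, e2, e3, integral_add i1 i2, integral_const_mul, integral_const_mul,
    hP.1.integral_eval hΛ, hQ.1.integral_eval hΛ, integral_const, probReal_univ, hP0] at hle
  have hγP := abs_pair_le (Λ := Λ) γ P (M := 1) fun k _ => by
    simpa [hP0] using norm_le_of_mem_Pbar hΛ (mem_Pbar_of_mem_Pplus hP) k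
  rw [dirDeriv, pair_sub, pair_sub, pair_oneCoeff h0, hγ0] at h
  simp only [Complex.one_re, smul_eq_mul, one_mul, mul_one] at hle h hγP
  have := le_of_abs_le hγP
  linarith

lemma exists_critical (hd1 : 1 ≤ d) (hd2 : d ≤ 2) (h0 : 0 ∈ Λ) (hΛ : ∀ k ∈ Λ, -k ∈ Λ)
    (hc : c ∈ Cplus d Λ) (hγ0 : γ 0 = 1) (hlam : 0 < lam) :
    ∃ P ∈ Ppluso d Λ, ∃ Q ∈ Pplus d Λ, ∀ H G, IsCoeff d Λ H → H 0 = 0 → IsCoeff d Λ G →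
      dirDeriv d Λ c γ lam P Q H G = 0 := by
  obtain ⟨κ, hκ, hpair⟩ := exists_mul_le_pair h0 hΛ hc
  set A : ℝ := (c 0).re + 1 with hA
  obtain ⟨η₁, hη₁, hP_low⟩ := exists_le_eval_of_integral_inv_le hd1 hd2 hΛ 1
    ((lam + (∑ k ∈ Λ, ‖γ k‖) + A + A / κ) / lam)
  obtain ⟨η₂, hη₂, hQ_low⟩ := exists_le_eval_of_integral_inv_le hd1 hd2 hΛ (A / κ) (A / η₁)
  set η := min (min η₁ η₂) 1 with hη
  have hη0 : 0 < η := lt_min (lt_min hη₁ hη₂) one_pos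
  have hη1 : η ≤ η₁ := (min_le_left _ _).trans (min_le_left _ _)
  have hη2 : η ≤ η₂ := (min_le_left _ _).trans (min_le_right _ _)
  have hη3 : η ≤ 1 := min_le_right _ _
  set δ := η / 2 with hδdef
  have hδ : 0 < δ := by positivity
  set B := max (A / κ) 1 + 1 with hB
  have hone : IsCoeff d Λ (oneCoeff d) := isCoeff_oneCoeff h0
  have hB1 : 1 ≤ B := by linarith [le_max_right (A / κ) 1]
  have h11 : (oneCoeff d, oneCoeff d) ∈ boxed d Λ δ B := by
    refine ⟨hone, hone, by simp [oneCoeff], by simpa [oneCoeff] using hB1, fun θ => ?_⟩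
    simp only [eval_oneCoeff h0]
    constructor <;> linarith
  obtain ⟨x, hx, hmin⟩ := (isCompact_boxed hΛ hδ).exists_isMinOn ⟨_, h11⟩
    (continuousOn_Jlam_boxed (c := c) (γ := γ) (lam := lam) (B := B) hΛ hδ)
  have hvar : ∀ y ∈ boxed d Λ δ B,
      0 ≤ dirDeriv d Λ c γ lam x.1 x.2 (y.1 - x.1) (y.2 - x.2) := fun y hy =>
    dirDeriv_nonneg_of_isMinOn hlam hδ hx (fun y hy => hmin hy) hy
  obtain ⟨P, Q⟩ := x
  have hP : P ∈ Pplus d Λ := fst_mem_Pplus_of_mem_boxed hδ hx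
  have hQ : Q ∈ Pplus d Λ := snd_mem_Pplus_of_mem_boxed hδ hx
  obtain ⟨-, -, hP0, hQB, hlow⟩ := hx
  simp only at hP0 hQB hlow hvar
  have b1 := pair_add_integral_div_le (γ := γ) (lam := lam) h0 hΛ hP hP0 hQ
    (hvar (P, oneCoeff d) ⟨hP.1, hone, hP0, h11.2.2.2.1, fun θ => ⟨(hlow θ).1, (h11.2.2.2.2 θ).2⟩⟩)
  have b2 := mul_integral_inv_le h0 hΛ hγ0 hP hP0 hQ
    (hvar (oneCoeff d, Q) ⟨hone, hQ.1, h11.2.2.1, hQB, fun θ => ⟨(h11.2.2.2.2 θ).1, (hlow θ).2⟩⟩)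
  have hPQ0 : 0 ≤ ∫ θ, eval d Λ P θ / eval d Λ Q θ ∂(dm d) := integral_nonneg fun θ =>
    (div_pos (eval_pos_of_mem_Pplus hP θ) (eval_pos_of_mem_Pplus hQ θ)).le
  have hcQ := hpair Q (mem_Pbar_of_mem_Pplus hQ)
  have hQ0 : 0 ≤ (Q 0).re :=
    (norm_nonneg _).trans (norm_le_of_mem_Pbar hΛ (mem_Pbar_of_mem_Pplus hQ) 0)
  have hQA : (Q 0).re ≤ A / κ := by
    rw [le_div_iff₀ hκ, mul_comm]
    linarith
  have hPQA : ∫ θ, eval d Λ P θ / eval d Λ Q θ ∂(dm d) ≤ A := by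
    have := mul_nonneg hκ.le hQ0
    linarith
  have hPη : ∀ θ, η₁ ≤ eval d Λ P θ := hP_low P hP (by simp [hP0]) (by
    rw [le_div_iff₀ hlam, mul_comm]
    linarith)
  have hQη : ∀ θ, η₂ ≤ eval d Λ Q θ := hQ_low Q hQ hQA (by
    rw [le_div_iff₀ hη₁, ← integral_mul_const]
    refine le_trans (integral_mono ?_ ?_ fun θ => ?_) hPQA
    · exact (integrable_dm_of_continuous (continuous_inv_eval hQ)).mul_const _
    · exact integrable_dm_of_continuous (continuous_eval_div_eval P hQ)
    · simp only
      rw [div_eq_inv_mul]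
      exact mul_le_mul_of_nonneg_left (hPη θ) (inv_nonneg.2 (eval_pos_of_mem_Pplus hQ θ).le))
  have hdir : ∀ H G, IsCoeff d Λ H → H 0 = 0 → IsCoeff d Λ G →
      0 ≤ dirDeriv d Λ c γ lam P Q H G := fun H G hH hH0 hG => by
    set N : ℝ := (∑ k ∈ Λ, ‖H k‖) + (∑ k ∈ Λ, ‖G k‖) + ‖G 0‖ + 1 with hN
    have hNpos : 0 < N := by positivity
    have hNH : ∑ k ∈ Λ, ‖H k‖ ≤ N := by
      have : 0 ≤ (∑ k ∈ Λ, ‖G k‖) + ‖G 0‖ := by positivity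
      linarith
    have hNG : ∑ k ∈ Λ, ‖G k‖ ≤ N := by
      have : 0 ≤ (∑ k ∈ Λ, ‖H k‖) + ‖G 0‖ := by positivity
      linarith
    have hNG0 : ‖G 0‖ ≤ N := by
      have : 0 ≤ (∑ k ∈ Λ, ‖H k‖) + ∑ k ∈ Λ, ‖G k‖ := by positivity
      linarith
    have hε : 0 < δ / N := by positivity
    have hbound : ∀ {u : ℝ}, |u| ≤ N → |δ / N * u| ≤ δ := fun {u} hu => by
      rw [abs_mul, abs_of_pos hε, div_mul_eq_mul_div, div_le_iff₀ hNpos]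
      exact mul_le_mul_of_nonneg_left hu hδ.le
    have hmem : (P + (δ / N) • H, Q + (δ / N) • G) ∈ boxed d Λ δ B := by
      refine ⟨hP.1.add (hH.smul _), hQ.1.add (hG.smul _), by simp [hP0, hH0], ?_, fun θ => ?_⟩
      · simp only [Pi.add_apply, Pi.smul_apply, Complex.add_re, Complex.smul_re, smul_eq_mul]
        have := le_of_abs_le (hbound ((Complex.abs_re_le_norm (G 0)).trans hNG0))
        linarith [le_max_left (A / κ) 1]
      · simp only [eval_add, eval_smul]
        have e1 := neg_le_of_abs_le (hbound ((abs_eval_le (Λ := Λ) H θ).trans hNH))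
        have e2 := neg_le_of_abs_le (hbound ((abs_eval_le (Λ := Λ) G θ).trans hNG))
        constructor
        · linarith [hPη θ]
        · linarith [hQη θ]
    have := hvar _ hmem
    simp only [add_sub_cancel_left] at this
    rw [dirDeriv_smul] at this
    exact nonneg_of_mul_nonneg_right this hε
  refine ⟨P, ⟨hP, hP0⟩, Q, hQ, fun H G hH hH0 hG => le_antisymm ?_ (hdir H G hH hH0 hG)⟩
  have := hdir _ _ (hH.smul (-1)) (by simp [hH0]) (hG.smul (-1))
  rw [dirDeriv_smul] at this
  linarith

lemma matches_of_critical (hΛ : ∀ k ∈ Λ, -k ∈ Λ) (hcc : IsCoeff d Λ c)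
    (hQ : Q ∈ Pplus d Λ)
    (hcrit : ∀ H G, IsCoeff d Λ H → H 0 = 0 → IsCoeff d Λ G →
      dirDeriv d Λ c γ lam P Q H G = 0) :
    Matches d Λ c (fun θ => eval d Λ P θ / eval d Λ Q θ) := by
  intro k hk
  have hΦ := continuous_eval_div_eval P hQ
  set Φ := fun θ => eval d Λ P θ / eval d Λ Q θ
  have ha : IsCoeff d Λ (c - coeff d Λ Φ) := hcc.sub (isCoeff_coeff hΛ Φ)
  have h := hcrit 0 _ isCoeff_zero rfl ha
  simp only [dirDeriv, eval_zero, pair_zero, mul_zero, zero_sub, sub_zero, integral_neg] at h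
  have hp : pair d Λ (coeff d Λ Φ) (c - coeff d Λ Φ) =
      ∫ θ, eval d Λ P θ / eval d Λ Q θ * eval d Λ (c - coeff d Λ Φ) θ ∂(dm d) :=
    pair_coeff hΛ hΦ ha
  rw [← hp, ← sub_eq_add_neg, ← pair_sub_left] at h
  have := eq_zero_of_pair_self h k hk
  rw [Pi.sub_apply, sub_eq_zero] at this
  rw [this, coeff, if_pos hk]

lemma cepstral_of_critical (h0 : 0 ∈ Λ) (hΛ : ∀ k ∈ Λ, -k ∈ Λ) (hγ : IsCoeff d Λ γ)
    (hP : P ∈ Pplus d Λ) (hQ : Q ∈ Pplus d Λ)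
    (hcrit : ∀ H G, IsCoeff d Λ H → H 0 = 0 → IsCoeff d Λ G →
      dirDeriv d Λ c γ lam P Q H G = 0) {k : Fin d → ℤ} (hk : k ∈ Λ) (hk0 : k ≠ 0) :
    γ k + (lam : ℂ) *
        ∫ θ, Complex.exp ((dotP d k θ : ℂ) * Complex.I) * ((eval d Λ P θ)⁻¹ : ℝ) ∂(dm d)
      = ∫ θ, Complex.exp ((dotP d k θ : ℂ) * Complex.I) *
          (Real.log (eval d Λ P θ / eval d Λ Q θ) : ℂ) ∂(dm d) := by
  have hψ := continuous_integrandDerivFst_eval (lam := lam) hP hQ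
  have hlog := continuous_log_eval_div (continuous_eval_right (Λ := Λ) P)
    (continuous_eval_right (Λ := Λ) Q) (eval_pos_of_mem_Pplus hP) (eval_pos_of_mem_Pplus hQ)
  have hinv := continuous_inv_eval hP
  set ψ := fun θ => integrandDerivFst lam (eval d Λ P θ) (eval d Λ Q θ) with hψdef
  set a := coeff d Λ ψ - γ with hadef
  have ha : IsCoeff d Λ a := (isCoeff_coeff hΛ ψ).sub hγ
  have hone := isCoeff_oneCoeff h0
  have hH : IsCoeff d Λ (a - (a 0).re • oneCoeff d) := ha.sub (hone.smul _)
  have hH0 : (a - (a 0).re • oneCoeff d) 0 = 0 := by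
    rw [Pi.sub_apply, Pi.smul_apply, oneCoeff, Pi.single_eq_same, Complex.real_smul, mul_one,
      ha.ofReal_re_zero, sub_self]
  have hHk : ∀ l ≠ 0, (a - (a 0).re • oneCoeff d) l = a l := fun l hl => by
    simp [oneCoeff, Pi.single_eq_of_ne hl]
  set H := a - (a 0).re • oneCoeff d
  have h := hcrit H 0 hH hH0 isCoeff_zero
  simp only [dirDeriv, eval_zero, pair_zero, mul_zero, sub_zero, zero_sub] at h
  have hp : pair d Λ (coeff d Λ ψ) H = ∫ θ, integrandDerivFst lam (eval d Λ P θ)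
      (eval d Λ Q θ) * eval d Λ H θ ∂(dm d) := pair_coeff hΛ hψ hH
  rw [← hp, neg_add_eq_sub, ← pair_sub_left] at h
  have hself : pair d Λ a H = pair d Λ H H := by
    rw [pair, pair]
    congr 1
    refine Finset.sum_congr rfl fun l _ => ?_
    rcases eq_or_ne l 0 with rfl | hl
    · simp [hH0]
    · rw [hHk l hl]
  rw [hself] at h
  have hak := eq_zero_of_pair_self h k hk
  rw [hHk k hk0, hadef, Pi.sub_apply, sub_eq_zero, coeff, if_pos hk] at hak
  have i1 : Integrable (fun θ => Complex.exp ((dotP d k θ : ℂ) * Complex.I) *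
      (Real.log (eval d Λ P θ / eval d Λ Q θ) : ℂ)) (dm d) :=
    integrable_dm_of_continuous ((by fun_prop : Continuous _).mul
      (Complex.continuous_ofReal.comp hlog))
  have i2 : Integrable (fun θ => Complex.exp ((dotP d k θ : ℂ) * Complex.I)) (dm d) :=
    integrable_dm_of_continuous (by fun_prop)
  have i3 : Integrable (fun θ => (lam : ℂ) * (Complex.exp ((dotP d k θ : ℂ) * Complex.I) *
      ((eval d Λ P θ)⁻¹ : ℝ))) (dm d) :=
    (integrable_dm_of_continuous ((by fun_prop : Continuous _).mul
      (Complex.continuous_ofReal.comp hinv))).const_mul _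
  have e : ∀ θ, Complex.exp ((dotP d k θ : ℂ) * Complex.I) * (ψ θ : ℂ) =
      Complex.exp ((dotP d k θ : ℂ) * Complex.I) *
        (Real.log (eval d Λ P θ / eval d Λ Q θ) : ℂ) +
      Complex.exp ((dotP d k θ : ℂ) * Complex.I) -
      (lam : ℂ) * (Complex.exp ((dotP d k θ : ℂ) * Complex.I) * ((eval d Λ P θ)⁻¹ : ℝ)) :=
    fun θ => by
      simp only [hψdef, integrandDerivFst]
      push_cast
      ring
  have e1 := integral_sub (i1.add i2) i3
  simp only [Pi.add_apply] at e1
  simp_rw [e] at hak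
  rw [e1, integral_add i1 i2, integral_exp_dotP, if_neg hk0, add_zero, integral_const_mul] at hak
  rw [← hak, sub_add_cancel]

/-- for d ≤ 2, c ∈ ℭ₊, cepstral data γ and λ > 0 the regularized
functional J_λ is strictly convex on 𝔓₊,∘ × 𝔓₊ and has a unique minimizer (P̂,Q̂)
there; Φ = P̂/Q̂ matches the covariances exactly and the cepstral coefficients
approximately, with error ε_k = λ ∫ e^{i(k,θ)} P̂⁻¹ dm. -/
theorem statement14 (d : ℕ) (hd1 : 1 ≤ d) (hd2 : d ≤ 2) (Λ : Finset (Fin d → ℤ))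
    (h0 : (0 : Fin d → ℤ) ∈ Λ) (hΛ : ∀ k ∈ Λ, -k ∈ Λ)
    (c γ : (Fin d → ℤ) → ℂ) (hc : c ∈ Cplus d Λ)
    (hγ : IsCoeff d Λ γ) (hγ0 : γ 0 = 1) (lam : ℝ) (hlam : 0 < lam) :
    StrictConvexOn ℝ (Ppluso d Λ ×ˢ Pplus d Λ)
      (fun PQ : ((Fin d → ℤ) → ℂ) × ((Fin d → ℤ) → ℂ) => Jlam d Λ c γ lam PQ.1 PQ.2) ∧
    ∃ Ph Qh : (Fin d → ℤ) → ℂ, Ph ∈ Ppluso d Λ ∧ Qh ∈ Pplus d Λ ∧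
      (∀ P' Q' : (Fin d → ℤ) → ℂ, P' ∈ Ppluso d Λ → Q' ∈ Pplus d Λ →
        Jlam d Λ c γ lam Ph Qh ≤ Jlam d Λ c γ lam P' Q') ∧
      (∀ P' Q' : (Fin d → ℤ) → ℂ, P' ∈ Ppluso d Λ → Q' ∈ Pplus d Λ →
        (∀ P'' Q'' : (Fin d → ℤ) → ℂ, P'' ∈ Ppluso d Λ → Q'' ∈ Pplus d Λ →
          Jlam d Λ c γ lam P' Q' ≤ Jlam d Λ c γ lam P'' Q'') →
        P' = Ph ∧ Q' = Qh) ∧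
      Matches d Λ c (fun θ => eval d Λ Ph θ / eval d Λ Qh θ) ∧
      ∀ k ∈ Λ, k ≠ 0 →
        γ k + (lam : ℂ) *
            ∫ θ, Complex.exp ((dotP d k θ : ℂ) * Complex.I) * ((eval d Λ Ph θ)⁻¹ : ℝ) ∂(dm d)
          = ∫ θ, Complex.exp ((dotP d k θ : ℂ) * Complex.I) *
              (Real.log (eval d Λ Ph θ / eval d Λ Qh θ) : ℂ) ∂(dm d) := by
  refine ⟨strictConvexOn_Jlam hΛ hlam, ?_⟩
  obtain ⟨P, hP, Q, hQ, hcrit⟩ := exists_critical hd1 hd2 h0 hΛ hc hγ0 hlam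
  have hcrit' : ∀ P' Q' : (Fin d → ℤ) → ℂ, P' ∈ Ppluso d Λ → Q' ∈ Pplus d Λ →
      dirDeriv d Λ c γ lam P Q (P' - P) (Q' - Q) = 0 := fun P' Q' hP' hQ' =>
    hcrit _ _ (hP'.1.1.sub hP.1.1) (by rw [Pi.sub_apply, hP'.2, hP.2, sub_self]) (hQ'.1.sub hQ.1)
  refine ⟨P, Q, hP, hQ, fun P' Q' hP' hQ' => ?_, fun P' Q' hP' hQ' hmin => ?_,
    matches_of_critical hΛ hc.1 hQ hcrit,
    fun k hk hk0 => cepstral_of_critical h0 hΛ hγ hP.1 hQ hcrit hk hk0⟩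
  · have := Jlam_tangent_le (c := c) (γ := γ) hlam hP.1 hQ hP'.1 hQ'
    rwa [hcrit' P' Q' hP' hQ', add_zero] at this
  · by_contra hne
    have := Jlam_tangent_lt (c := c) (γ := γ) hΛ hlam hP.1 hQ hP'.1 hQ' hne
    rw [hcrit' P' Q' hP' hQ', add_zero] at this
    exact absurd (hmin P Q hP hQ) (not_le.2 this)

end RCE
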